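/- Let (X, dist) be a compact metric space, φ : ℝ → X → X a continuous flow (φ₀ = id and φ_{s+t} = φ_s ∘ φ_t), and ν a Borel probability measure on X of full support such that for every x ∈ X and every continuous g : X → ℝ, (1/N)·∑_{a=0}^{N−1} g(φ_a(x)) → ∫_X g dν. Let (qₙ) be a sequence of primes and c₀, δ > 0 with q_{n+1} ≥ c₀·e^{δ·qₙ} for all n, let 0 < d < δ, set Kₙ = ⌈e^{d·qₙ}⌉, and assume sup_{x∈X} sup_{0 ≤ K ≤ Kₙ} dist(φ_{K·qₙ}(x), x) → 0 as n → ∞. Then for every x ∈ X, the set {φ_p(x) : p prime} is dense in X. -/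

import Mathlib

open Finset in
lemma aux_abel (c : ℕ → ℂ) (f : ℕ → ℝ) (hf : Antitone f) (h0 : ∀ n, 0 ≤ f n) (S : ℝ)
    (hS : ∀ n, ‖∑ i ∈ range n, c i‖ ≤ S) (M : ℕ) :
    ‖∑ i ∈ range M, (f i : ℂ) * c i‖ ≤ S * f 0 := by
  have hS0 : 0 ≤ S := le_trans (norm_nonneg _) (hS 0)
  have key : ∀ M : ℕ, ‖∑ i ∈ range M, (f i : ℂ) * c i - (f M : ℂ) * ∑ i ∈ range M, c i‖
      ≤ S * (f 0 - f M) := by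
    intro M
    induction M with
    | zero => simp
    | succ M ih =>
      have e : ∑ i ∈ range (M+1), (f i : ℂ) * c i - (f (M+1) : ℂ) * ∑ i ∈ range (M+1), c i
        = (∑ i ∈ range M, (f i : ℂ) * c i - (f M : ℂ) * ∑ i ∈ range M, c i)
          + ((f M - f (M+1) : ℝ) : ℂ) * ∑ i ∈ range (M+1), c i := by
        rw [sum_range_succ, sum_range_succ]; push_cast; ring
      rw [e]
      refine (norm_add_le _ _).trans ?_
      have h1 : 0 ≤ f M - f (M+1) := sub_nonneg.mpr (hf (Nat.le_succ M))
      have h2 : ‖((f M - f (M+1) : ℝ) : ℂ) * ∑ i ∈ range (M+1), c i‖ ≤ (f M - f (M+1)) * S := by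
        rw [norm_mul, Complex.norm_real, Real.norm_of_nonneg h1]
        exact mul_le_mul_of_nonneg_left (hS _) h1
      linarith
  have h := key M
  have e : ∑ i ∈ range M, (f i : ℂ) * c i = (∑ i ∈ range M, (f i : ℂ) * c i - (f M : ℂ) * ∑ i ∈ range M, c i)
    + (f M : ℂ) * ∑ i ∈ range M, c i := by ring
  rw [e]
  refine (norm_add_le _ _).trans ?_
  have h2 : ‖(f M : ℂ) * ∑ i ∈ range M, c i‖ ≤ f M * S := by
    rw [norm_mul, Complex.norm_real, Real.norm_of_nonneg (h0 M)]
    exact mul_le_mul_of_nonneg_left (hS _) (h0 M)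
  linarith

open Finset in
lemma aux_period {q : ℕ} [Fact q.Prime] (χ : DirichletCharacter ℂ q) (hχ : χ ≠ 1) (N : ℕ) :
    ∑ i ∈ range q, χ ((N + i : ℕ) : ZMod q) = 0 := by
  have h := MulChar.sum_eq_zero_of_ne_one hχ
  rw [← h]
  have hq : NeZero q := ⟨(Fact.out : q.Prime).ne_zero⟩
  refine Finset.sum_bij' (fun i _ => ((N + i : ℕ) : ZMod q)) (fun a _ => (a - N : ZMod q).val) ?_ ?_ ?_ ?_ ?_
  · intros; simp
  · intro a _; simpa using ZMod.val_lt _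
  · intro i hi
    simp only [mem_range] at hi
    simp [ZMod.val_cast_of_lt hi]
  · intro a _; simp
  · intros; rfl

open Finset in
lemma aux_mod {q : ℕ} [Fact q.Prime] (χ : DirichletCharacter ℂ q) (hχ : χ ≠ 1) (N n : ℕ) :
    ∑ i ∈ range n, χ ((N + i : ℕ) : ZMod q) = ∑ i ∈ range (n % q), χ ((N + i : ℕ) : ZMod q) := by
  conv_lhs => rw [← Nat.mod_add_div n q]
  generalize n / q = k
  induction k with
  | zero => simp
  | succ k ih =>
    rw [Nat.mul_succ, ← add_assoc, sum_range_add, ih]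
    have := aux_period χ hχ (N + (n % q + q * k))
    simp only [← add_assoc] at this ⊢
    rw [this]; simp

open Finset in
lemma aux_trivS {q : ℕ} [Fact q.Prime] (χ : DirichletCharacter ℂ q) (hχ : χ ≠ 1) (N n : ℕ) :
    ‖∑ i ∈ range n, χ ((N + i : ℕ) : ZMod q)‖ ≤ q := by
  rw [aux_mod χ hχ]
  refine (norm_sum_le _ _).trans ?_
  refine (sum_le_sum (fun i _ => χ.norm_le_one _)).trans ?_
  simp
  exact (Nat.mod_lt _ (Fact.out : q.Prime).pos).le

open Finset in
lemma aux_corr {q : ℕ} [Fact q.Prime] (χ : DirichletCharacter ℂ q) (hχ : χ ≠ 1) (u v : ZMod q)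
    (huv : u ≠ v) :
    ∑ x : ZMod q, χ (x + u) * (starRingEnd ℂ) (χ (x + v)) = -1 := by
  -- substitute x = -v + (u - v) * t... use y = (x+u)/(x+v)
  have h := MulChar.sum_eq_zero_of_ne_one hχ
  have h1 : ∑ y ∈ univ.erase (1 : ZMod q), χ y = -1 := by
    rw [← Finset.add_sum_erase univ _ (mem_univ (1 : ZMod q))] at h
    rw [map_one] at h
    linear_combination h
  rw [← h1]
  have h2 : ∑ x : ZMod q, χ (x + u) * (starRingEnd ℂ) (χ (x + v)) =
      ∑ x ∈ univ.erase (-v), χ ((x + u) * (x + v)⁻¹) := by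
    rw [← Finset.add_sum_erase univ _ (mem_univ (-v))]
    have : χ (-v + v) = 0 := by rw [neg_add_cancel]; exact MulChar.map_zero χ
    rw [this]; simp only [map_zero, mul_zero, zero_add]
    refine sum_congr rfl ?_
    intro x hx
    rw [map_mul]
    congr 1
    rw [show (starRingEnd ℂ) (χ (x+v)) = star (χ (x+v)) from rfl, MulChar.star_apply', MulChar.inv_apply']
  rw [h2]
  have huv' : u - v ≠ 0 := sub_ne_zero.mpr huv
  refine Finset.sum_bij' (fun x _ => (x + u) * (x + v)⁻¹) (fun y _ => (u - v) * (y - 1)⁻¹ - v) ?_ ?_ ?_ ?_ ?_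
  · intro x hx
    simp only [mem_erase, mem_univ, and_true] at hx ⊢
    have : x + v ≠ 0 := fun h => hx (eq_neg_of_add_eq_zero_left h)
    intro h
    rw [mul_inv_eq_one₀ this] at h
    exact huv (add_left_cancel h)
  · intro y hy
    simp only [mem_erase, mem_univ, and_true] at hy ⊢
    have : y - 1 ≠ 0 := sub_ne_zero.mpr hy
    intro h
    have h' : (u - v) * (y - 1)⁻¹ = 0 := by linear_combination h
    exact (mul_ne_zero huv' (inv_ne_zero this)) h'
  · intro x hx
    simp only [mem_erase, mem_univ, and_true] at hx ⊢
    have : x + v ≠ 0 := fun h => hx (eq_neg_of_add_eq_zero_left h)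
    have e : (x + u) * (x + v)⁻¹ - 1 = (u - v) * (x + v)⁻¹ := by field_simp; ring
    rw [e]; field_simp; ring
  · intro y hy
    simp only [mem_erase, mem_univ, and_true] at hy ⊢
    have : y - 1 ≠ 0 := sub_ne_zero.mpr hy
    have e : (u - v) * (y - 1)⁻¹ - v + v = (u - v) * (y - 1)⁻¹ := by ring
    rw [e]; field_simp; ring
  · intros; rfl

open Finset in
lemma aux_second {q : ℕ} [Fact q.Prime] (χ : DirichletCharacter ℂ q) (hχ : χ ≠ 1) (H : ℕ) (hH : H ≤ q) :
    ∑ x : ZMod q, ‖∑ h ∈ range H, χ (x + (h : ZMod q))‖ ^ 2 ≤ H * q := by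
  have e : ((∑ x : ZMod q, ‖∑ h ∈ range H, χ (x + (h : ZMod q))‖ ^ 2 : ℝ) : ℂ)
     = ∑ h ∈ range H, ∑ k ∈ range H, ∑ x : ZMod q, χ (x + h) * (starRingEnd ℂ) (χ (x + k)) := by
    push_cast
    have : ∀ x : ZMod q, ((‖∑ h ∈ range H, χ (x + (h : ZMod q))‖ : ℂ)) ^ 2 =
       ∑ h ∈ range H, ∑ k ∈ range H, χ (x + h) * (starRingEnd ℂ) (χ (x + k)) := by
      intro x
      rw [← Complex.mul_conj', map_sum, sum_mul_sum]
    simp_rw [this]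
    rw [sum_comm]
    refine sum_congr rfl fun h _ => ?_
    rw [sum_comm]
  have e2 : (∑ x : ZMod q, ‖∑ h ∈ range H, χ (x + (h : ZMod q))‖ ^ 2 : ℝ)
     = ∑ h ∈ range H, ∑ k ∈ range H, (∑ x : ZMod q, χ (x + h) * (starRingEnd ℂ) (χ (x + k))).re := by
    rw [← Complex.ofReal_re (∑ x : ZMod q, ‖∑ h ∈ range H, χ (x + (h : ZMod q))‖ ^ 2 : ℝ), e]
    simp only [Complex.re_sum]
  rw [e2]
  calc _ ≤ ∑ h ∈ range H, ∑ k ∈ range H, (if h = k then (q : ℝ) else 0) := by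
        refine sum_le_sum fun h hh => sum_le_sum fun k hk => ?_
        simp only [mem_range] at hh hk
        split_ifs with hk'
        · refine (Complex.re_le_norm _).trans ?_
          refine (norm_sum_le _ _).trans ?_
          refine (sum_le_sum (g := fun _ => (1:ℝ)) (fun i _ => ?_)).trans ?_
          · rw [norm_mul, RCLike.norm_conj]
            exact mul_le_one₀ (χ.norm_le_one _) (norm_nonneg _) (χ.norm_le_one _)
          · simp [ZMod.card]
        · rw [aux_corr χ hχ]
          · simp
          · intro h'
            apply hk'
            have := congrArg ZMod.val h'
            rwa [ZMod.val_cast_of_lt (by omega), ZMod.val_cast_of_lt (by omega)] at this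
    _ = H * q := by
        simp only [sum_ite_eq, mem_range]
        rw [sum_congr rfl (fun x hx => if_pos (mem_range.mp hx))]
        simp

open Finset in
lemma aux_pv {q : ℕ} [Fact q.Prime] (χ : DirichletCharacter ℂ q) (hχ : χ ≠ 1) (H : ℕ) (hH : H ≤ q)
    (hH0 : 0 < H) (N n : ℕ) :
    ‖∑ i ∈ range n, χ ((N + i : ℕ) : ZMod q)‖ ≤ 2 * H + q / √H := by
  rw [aux_mod χ hχ]
  set m := n % q with hm
  have hmq : m < q := Nat.mod_lt _ (Fact.out : q.Prime).pos
  clear_value m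
  set T := ∑ i ∈ range m, χ ((N + i : ℕ) : ZMod q) with hT
  have shift : ∀ h : ℕ, ‖T - ∑ i ∈ range m, χ ((N + i + h : ℕ) : ZMod q)‖ ≤ 2 * h := by
    intro h
    have e : T - ∑ i ∈ range m, χ ((N + i + h : ℕ) : ZMod q) =
        ∑ i ∈ range h, χ ((N + i : ℕ) : ZMod q) - ∑ i ∈ range h, χ ((N + (m + i) : ℕ) : ZMod q) := by
      have a := sum_range_add (fun i => χ ((N + i : ℕ) : ZMod q)) m h
      have b := sum_range_add (fun i => χ ((N + i : ℕ) : ZMod q)) h m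
      rw [add_comm m h] at a
      have c : ∑ i ∈ range m, χ ((N + i + h : ℕ) : ZMod q) = ∑ i ∈ range m, χ ((N + (h + i) : ℕ) : ZMod q) := by
        refine sum_congr rfl fun i _ => ?_
        congr 2; ring
      rw [c]
      linear_combination b - a
    rw [e]
    refine (norm_sub_le _ _).trans ?_
    have g : ∀ F : ℕ → ZMod q, ‖∑ i ∈ range h, χ (F i)‖ ≤ h := by
      intro F
      refine (norm_sum_le _ _).trans ?_
      refine (sum_le_sum (fun i _ => χ.norm_le_one _)).trans ?_
      simp
    have := g (fun i => ((N + i : ℕ) : ZMod q))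
    have := g (fun i => ((N + (m + i) : ℕ) : ZMod q))
    linarith
  have h1 : ‖(H : ℂ) * T - ∑ i ∈ range m, ∑ h ∈ range H, χ (((N + i : ℕ) : ZMod q) + (h : ZMod q))‖ ≤ H * (2 * H) := by
    have e : (H : ℂ) * T - ∑ i ∈ range m, ∑ h ∈ range H, χ (((N + i : ℕ) : ZMod q) + (h : ZMod q)) =
       ∑ h ∈ range H, (T - ∑ i ∈ range m, χ ((N + i + h : ℕ) : ZMod q)) := by
      rw [sum_sub_distrib, sum_const, card_range, nsmul_eq_mul, sum_comm]
      push_cast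
      rfl
    rw [e]
    refine (norm_sum_le _ _).trans ?_
    refine (sum_le_sum (g := fun _ => (2 * H : ℝ)) (fun i hi => (shift i).trans ?_)).trans ?_
    · have : (i : ℝ) ≤ H := by exact_mod_cast (mem_range.mp hi).le
      linarith
    · simp
  have h2 : ‖∑ i ∈ range m, ∑ h ∈ range H, χ (((N + i : ℕ) : ZMod q) + (h : ZMod q))‖ ≤ q * √H := by
    refine (norm_sum_le _ _).trans ?_
    have cs := sum_mul_sq_le_sq_mul_sq (range m) (fun _ => (1:ℝ)) (fun i => ‖∑ h ∈ range H, χ (((N + i : ℕ) : ZMod q) + (h : ZMod q))‖)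
    simp only [one_mul, one_pow, sum_const, card_range, nsmul_eq_mul, mul_one] at cs
    have le : ∑ i ∈ range m, ‖∑ h ∈ range H, χ (((N + i : ℕ) : ZMod q) + (h : ZMod q))‖ ^ 2 ≤ H * q := by
      refine le_trans ?_ (aux_second χ hχ H hH)
      have inj : Set.InjOn (fun i : ℕ => ((N + i : ℕ) : ZMod q)) (range m) := by
        intro i hi j hj hij
        simp only [coe_range, Set.mem_Iio] at hi hj
        simp only [Nat.cast_add, add_right_inj] at hij
        have := congrArg ZMod.val hij
        rwa [ZMod.val_cast_of_lt (by omega), ZMod.val_cast_of_lt (by omega)] at this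
      rw [← sum_image (g := fun i : ℕ => ((N + i : ℕ) : ZMod q)) (f := fun x => ‖∑ h ∈ range H, χ (x + (h : ZMod q))‖ ^ 2) inj]
      exact sum_le_sum_of_subset_of_nonneg (subset_univ _) (fun _ _ _ => by positivity)
    refine (sq_le_sq₀ (by positivity) (by positivity)).mp ?_
    rw [mul_pow, Real.sq_sqrt (by positivity)]
    have hm' : (m : ℝ) ≤ q := by exact_mod_cast hmq.le
    calc _ ≤ _ := cs
      _ ≤ q * (H * q) := by gcongr
      _ = _ := by ring
  have hHp : (0:ℝ) < H := by exact_mod_cast hH0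
  have h3 : ‖(H : ℂ) * T‖ ≤ H * (2 * H) + q * √H := by
    have := norm_sub_norm_le ((H : ℂ) * T) (∑ i ∈ range m, ∑ h ∈ range H, χ (((N + i : ℕ) : ZMod q) + (h : ZMod q)))
    linarith
  rw [norm_mul, Complex.norm_natCast] at h3
  have h4 : (H:ℝ) * (2 * H + q / √H) = H * (2 * H) + q * √H := by
    have : √(H:ℝ) ≠ 0 := by positivity
    have h5 : (H:ℝ) = √H * √H := (Real.mul_self_sqrt hHp.le).symm
    have : (H:ℝ) * (q / √H) = q * √H := by
      field_simp; nlinarith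
    linarith
  rw [← h4] at h3
  exact le_of_mul_le_mul_left h3 hHp

lemma aux_pv' {q : ℕ} [Fact q.Prime] (χ : DirichletCharacter ℂ q) (hχ : χ ≠ 1) (N n : ℕ) :
    ‖∑ i ∈ Finset.range n, χ ((N + i : ℕ) : ZMod q)‖ ≤ 5 * (q:ℝ) ^ (3/4 : ℝ) := by
  have hq : 2 ≤ q := (Fact.out : q.Prime).two_le
  have hq1 : (1:ℝ) ≤ q := by exact_mod_cast (by omega : 1 ≤ q)
  have hs : √(q:ℝ) = (q:ℝ)^(1/2:ℝ) := Real.sqrt_eq_rpow _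
  set H := ⌈√(q:ℝ)⌉₊ with hHd
  have h1 : √(q:ℝ) ≤ H := Nat.le_ceil _
  have h1' : (1:ℝ) ≤ √(q:ℝ) := Real.one_le_sqrt.mpr hq1
  have h2 : (H:ℝ) < √(q:ℝ) + 1 := Nat.ceil_lt_add_one (by positivity)
  have h3 : H ≤ q := by
    apply Nat.ceil_le.mpr
    refine Real.sqrt_le_iff.mpr ⟨by positivity, ?_⟩
    nlinarith
  have h4 : 0 < H := Nat.ceil_pos.mpr (by positivity)
  refine (aux_pv χ hχ H h3 h4 N n).trans ?_
  have h5 : (q:ℝ) / √H ≤ (q:ℝ) ^ (3/4 : ℝ) := by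
    have : (q:ℝ) ^ (1/4 : ℝ) ≤ √H := by
      rw [show (1/4:ℝ) = (1/2)*(1/2) by norm_num, Real.rpow_mul (by positivity), ← hs, ← Real.sqrt_eq_rpow]
      exact Real.sqrt_le_sqrt h1
    calc (q:ℝ) / √H ≤ q / (q:ℝ) ^ (1/4 : ℝ) := by gcongr
      _ = _ := by
        rw [div_eq_iff (by positivity), ← Real.rpow_add (by positivity)]
        norm_num
  have h6 : √(q:ℝ) ≤ (q:ℝ) ^ (3/4 : ℝ) := by
    rw [hs]; exact Real.rpow_le_rpow_of_exponent_le hq1 (by norm_num)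
  linarith


open Finset in
lemma aux_tail {q : ℕ} [Fact q.Prime] (χ : DirichletCharacter ℂ q) (S : ℝ)
    (hS : ∀ N n : ℕ, ‖∑ i ∈ range n, χ ((N + i : ℕ) : ZMod q)‖ ≤ S) (f : ℕ → ℝ) (N : ℕ)
    (hanti : ∀ m n, N ≤ m → m ≤ n → f n ≤ f m) (hnn : ∀ n, 0 ≤ f n) (F : ℕ → ℂ) (hF : Summable F)
    (hFf : ∀ n, F n = f n * χ (n : ZMod q)) :
    ‖∑' n, F n - ∑ n ∈ range N, F n‖ ≤ S * f N := by
  have h := hF.sum_add_tsum_nat_add N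
  have e : ∑' n, F n - ∑ n ∈ range N, F n = ∑' n, F (n + N) := by rw [← h]; ring
  rw [e]
  have ht := ((summable_nat_add_iff N).mpr hF).hasSum.tendsto_sum_nat.norm
  refine le_of_tendsto' ht fun M => ?_
  have := aux_abel (fun i => χ ((N + i : ℕ) : ZMod q)) (fun i => f (N + i))
    (fun a b hab => hanti _ _ (by omega) (by omega)) (fun n => hnn _) S (fun n => hS N n) M
  simp only [add_zero] at this
  refine le_trans (le_of_eq ?_) this
  congr 1
  refine sum_congr rfl fun i _ => ?_
  rw [hFf, add_comm i N]

lemma aux_term {q : ℕ} [Fact q.Prime] (χ : DirichletCharacter ℂ q) (s : ℝ) (n : ℕ) :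
    LSeries.term (fun n : ℕ => χ (n : ZMod q)) (s : ℂ) n = ((1 / (n:ℝ) ^ s : ℝ) : ℂ) * χ (n : ZMod q) := by
  rcases eq_or_ne n 0 with rfl | hn
  · have : χ ((0:ℕ) : ZMod q) = 0 := by rw [Nat.cast_zero]; exact MulChar.map_zero χ
    rw [this]; simp
  · rw [LSeries.term_of_ne_zero hn]
    rw [Complex.ofReal_div, Complex.ofReal_cpow (by positivity)]
    push_cast; ring

lemma aux_termlog {q : ℕ} [Fact q.Prime] (χ : DirichletCharacter ℂ q) (s : ℝ) (n : ℕ) :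
    LSeries.term (LSeries.logMul (fun n : ℕ => χ (n : ZMod q))) (s : ℂ) n
      = ((Real.log n / (n:ℝ) ^ s : ℝ) : ℂ) * χ (n : ZMod q) := by
  rcases eq_or_ne n 0 with rfl | hn
  · have : χ ((0:ℕ) : ZMod q) = 0 := by rw [Nat.cast_zero]; exact MulChar.map_zero χ
    rw [this]; simp
  · rw [LSeries.term_of_ne_zero hn, LSeries.logMul]
    rw [Complex.ofReal_div, Complex.ofReal_cpow (by positivity), ← Complex.natCast_log]
    push_cast; ring

open Finset in
lemma aux_Ltail {q : ℕ} [Fact q.Prime] (χ : DirichletCharacter ℂ q) (S : ℝ)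
    (hS : ∀ N n : ℕ, ‖∑ i ∈ range n, χ ((N + i : ℕ) : ZMod q)‖ ≤ S) (s : ℝ) (hs : 1 < s)
    (N : ℕ) (hN : 1 ≤ N) :
    ‖DirichletCharacter.LFunction χ s - ∑ n ∈ range N, ((1 / (n:ℝ) ^ s : ℝ) : ℂ) * χ (n : ZMod q)‖
      ≤ S * (1 / (N:ℝ) ^ s) := by
  have hsum := DirichletCharacter.LSeriesSummable_of_one_lt_re χ (s := (s:ℂ)) (by simpa using hs)
  rw [DirichletCharacter.LFunction_eq_LSeries χ (by simpa using hs)]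
  have := aux_tail χ S hS (fun n => 1 / (n:ℝ) ^ s) N ?_ (fun n => by positivity) _ hsum (aux_term χ s)
  · rw [LSeries]
    simp_rw [← aux_term]
    exact this
  · intro m n hm hmn
    have : (0:ℝ) < m := by exact_mod_cast (by omega : 0 < m)
    have : (m:ℝ) ≤ n := by exact_mod_cast hmn
    gcongr

lemma aux_harm (q : ℕ) (hq : 1 ≤ q) (s : ℝ) (hs : 1 < s) :
    ∑ n ∈ Finset.range q, 1 / (n:ℝ) ^ s ≤ 1 + Real.log q := by
  have h := harmonic_le_one_add_log q
  refine le_trans ?_ h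
  rw [harmonic_eq_sum_Icc]
  push_cast
  have : ∑ n ∈ Finset.range q, 1 / (n:ℝ) ^ s ≤ ∑ n ∈ Finset.range (q+1), 1 / (n:ℝ) ^ s :=
    Finset.sum_le_sum_of_subset_of_nonneg (Finset.range_subset_range.mpr (by omega)) (fun _ _ _ => by positivity)
  refine this.trans ?_
  have e : Finset.range (q+1) = insert 0 (Finset.Icc 1 q) := by
    ext x; simp; omega
  rw [e, Finset.sum_insert (by simp)]
  have : (1:ℝ) / ((0:ℕ):ℝ) ^ s = 0 := by
    rw [Nat.cast_zero, Real.zero_rpow (by linarith)]; simp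
  rw [this, zero_add]
  refine Finset.sum_le_sum fun n hn => ?_
  have h1 : (1:ℝ) ≤ n := by exact_mod_cast (Finset.mem_Icc.mp hn).1
  rw [← one_div]
  have : (n:ℝ) ≤ (n:ℝ)^s := by
    conv_lhs => rw [← Real.rpow_one (n:ℝ)]
    exact Real.rpow_le_rpow_of_exponent_le h1 hs.le
  gcongr

open Finset in
lemma aux_L {q : ℕ} [Fact q.Prime] (χ : DirichletCharacter ℂ q) (hχ : χ ≠ 1) (s : ℝ) (hs : 1 < s) :
    ‖DirichletCharacter.LFunction χ s‖ ≤ (2 + Real.log q) ^ 2 := by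
  have hq : 2 ≤ q := (Fact.out : q.Prime).two_le
  have hq1 : (1:ℝ) ≤ q := by exact_mod_cast (by omega : 1 ≤ q)
  have hl := Real.log_nonneg hq1
  have h := aux_Ltail χ q (aux_trivS χ hχ) s hs q (by omega)
  have h2 : ‖∑ n ∈ range q, ((1 / (n:ℝ) ^ s : ℝ) : ℂ) * χ (n : ZMod q)‖ ≤ 1 + Real.log q := by
    refine (norm_sum_le _ _).trans ?_
    refine le_trans (sum_le_sum fun n _ => ?_) (aux_harm q (by omega) s hs)
    rw [norm_mul, Complex.norm_real, Real.norm_of_nonneg (by positivity)]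
    exact mul_le_of_le_one_right (by positivity) (χ.norm_le_one _)
  have h3 : (q:ℝ) * (1 / (q:ℝ) ^ s) ≤ 1 := by
    rw [mul_one_div, div_le_one (by positivity)]
    conv_lhs => rw [← Real.rpow_one (q:ℝ)]
    exact Real.rpow_le_rpow_of_exponent_le hq1 hs.le
  have h4 := norm_sub_norm_le (DirichletCharacter.LFunction χ s) (∑ n ∈ range q, ((1 / (n:ℝ) ^ s : ℝ) : ℂ) * χ (n : ZMod q))
  nlinarith

open Finset in
lemma aux_L' {q : ℕ} [Fact q.Prime] (χ : DirichletCharacter ℂ q) (hχ : χ ≠ 1) (hq3 : 3 ≤ q)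
    (s : ℝ) (hs : 1 < s) :
    ‖deriv (DirichletCharacter.LFunction χ) s‖ ≤ (2 + Real.log q) ^ 2 := by
  have hq1 : (1:ℝ) ≤ q := by exact_mod_cast (by omega : 1 ≤ q)
  have hl := Real.log_nonneg hq1
  have hab : LSeries.abscissaOfAbsConv (fun n : ℕ => χ (n : ZMod q)) < ((s:ℂ)).re := by
    rw [DirichletCharacter.absicssaOfAbsConv_eq_one (by omega)]
    simpa using (by exact_mod_cast hs : (1:EReal) < (s:EReal))
  rw [DirichletCharacter.deriv_LFunction_eq_deriv_LSeries χ (by simpa using hs),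
    LSeries_deriv hab, norm_neg]
  have hsum := LSeriesSummable_logMul_of_lt_re hab
  have h := aux_tail χ q (aux_trivS χ hχ) (fun n => Real.log n / (n:ℝ) ^ s) q ?_ ?_ _ hsum (aux_termlog χ s)
  rotate_left
  · intro m n hm hmn
    have h0 : Real.exp (1 / s) ≤ 3 := by
      have : Real.exp (1/s) ≤ Real.exp 1 := Real.exp_le_exp.mpr (by
        rw [div_le_one (by linarith)]; exact hs.le)
      have := Real.exp_one_lt_d9
      linarith
    have h1 : (3:ℝ) ≤ m := by exact_mod_cast (by omega : 3 ≤ m)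
    have h2 : (m:ℝ) ≤ n := by exact_mod_cast hmn
    exact Real.log_div_self_rpow_antitoneOn (a := s) (by linarith) (by rw [Set.mem_Ici, ← one_div]; linarith) (by rw [Set.mem_Ici, ← one_div]; linarith) h2
  · intro n
    have := Real.log_natCast_nonneg n
    positivity
  have h2 : ‖∑ n ∈ range q, LSeries.term (LSeries.logMul (fun n : ℕ => χ (n : ZMod q))) (s : ℂ) n‖
      ≤ Real.log q * (1 + Real.log q) := by
    refine (norm_sum_le _ _).trans ?_
    refine le_trans (sum_le_sum (g := fun n : ℕ => Real.log q * (1 / (n:ℝ) ^ s)) fun n hn => ?_) ?_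
    · rw [aux_termlog]
      have := Real.log_natCast_nonneg n
      rw [norm_mul, Complex.norm_real, Real.norm_of_nonneg (by positivity)]
      refine (mul_le_of_le_one_right (by positivity) (χ.norm_le_one _)).trans ?_
      rw [mul_one_div]
      rcases Nat.eq_zero_or_pos n with rfl | hn0
      · simp; positivity
      have : (0:ℝ) < n := by exact_mod_cast hn0
      have : (n:ℝ) ≤ q := by exact_mod_cast (mem_range.mp hn).le
      gcongr
    · rw [← mul_sum]
      exact mul_le_mul_of_nonneg_left (aux_harm q (by omega) s hs) hl
  have h3 : (q:ℝ) * (Real.log q / (q:ℝ) ^ s) ≤ Real.log q := by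
    have : (q:ℝ) ≤ (q:ℝ)^s := by
      conv_lhs => rw [← Real.rpow_one (q:ℝ)]
      exact Real.rpow_le_rpow_of_exponent_le hq1 hs.le
    rw [mul_div_left_comm]
    refine mul_le_of_le_one_right hl ?_
    rw [div_le_one (by positivity)]; exact this
  rw [LSeries]
  have h4 := norm_sub_norm_le (∑' n, LSeries.term (LSeries.logMul (fun n : ℕ => χ (n : ZMod q))) (s : ℂ) n) (∑ n ∈ range q, LSeries.term (LSeries.logMul (fun n : ℕ => χ (n : ZMod q))) (s : ℂ) n)
  nlinarith

/-- mean value bound -/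
lemma aux_mvt {q : ℕ} [Fact q.Prime] (χ : DirichletCharacter ℂ q) (hχ : χ ≠ 1) (hq3 : 3 ≤ q)
    (s t : ℝ) (hs : 1 ≤ s) (ht : s ≤ t) :
    ‖DirichletCharacter.LFunction χ t - DirichletCharacter.LFunction χ s‖ ≤ (2 + Real.log q) ^ 2 * (t - s) := by
  have hd := DirichletCharacter.differentiable_LFunction hχ
  have hder : ∀ x : ℝ, HasDerivAt (fun x : ℝ => DirichletCharacter.LFunction χ (x:ℂ))
      (deriv (DirichletCharacter.LFunction χ) x) x := fun x =>
    (hd x).hasDerivAt.comp_ofReal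
  refine norm_image_sub_le_of_norm_deriv_right_le_segment (f := fun x : ℝ => DirichletCharacter.LFunction χ (x:ℂ))
    (f' := fun x : ℝ => deriv (DirichletCharacter.LFunction χ) x) (C := (2 + Real.log q) ^ 2) (a := s) (b := t) ?_ ?_ ?_ t ⟨ht, le_rfl⟩
  · exact fun x _ => (hder x).continuousAt.continuousWithinAt
  · exact fun x _ => (hder x).hasDerivWithinAt
  · intro x hx
    rcases eq_or_lt_of_le (hs.trans hx.1) with h1 | h1
    · have hc : Continuous (deriv (DirichletCharacter.LFunction χ)) := (hd.contDiff (n := 1)).continuous_deriv (by norm_num)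
      have hc' : Filter.Tendsto (fun y : ℝ => ‖deriv (DirichletCharacter.LFunction χ) (y:ℂ)‖) (nhdsWithin x (Set.Ioi x)) (nhds ‖deriv (DirichletCharacter.LFunction χ) (x:ℂ)‖) :=
        ((hc.comp Complex.continuous_ofReal).norm.tendsto x).mono_left nhdsWithin_le_nhds
      refine le_of_tendsto hc' ?_
      filter_upwards [self_mem_nhdsWithin] with y hy
      exact aux_L' χ hχ hq3 y (by rw [h1]; exact hy)
    · exact aux_L' χ hχ hq3 x h1

/-- zeta bound for the principal character -/
lemma aux_zeta {q : ℕ} [Fact q.Prime] (x : ℝ) (hx : 0 < x) (hx1 : x ≤ 1) :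
    ‖DirichletCharacter.LFunctionTrivChar q (1 + x)‖ ≤ 2 / x := by
  have hre : 1 < (1 + (x:ℂ)).re := by simpa using hx
  rw [DirichletCharacter.LFunctionTrivChar, DirichletCharacter.LFunction_eq_LSeries 1 hre, LSeries]
  have hs : (1:ℝ) < 1 + x := by linarith
  have hsum := DirichletCharacter.LSeriesSummable_of_one_lt_re (1 : DirichletCharacter ℂ q) hre
  have h1 : Summable (fun n : ℕ => 1 / ((n:ℝ)) ^ (1 + x)) := Real.summable_one_div_nat_rpow.mpr hs
  have h2 := ZetaAsymptotics.zeta_limit_aux1 hs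
  have h3 : 0 ≤ ZetaAsymptotics.termTSum (1 + x) := tsum_nonneg fun n => ZetaAsymptotics.term_nonneg _ _
  have h4 := h1.tsum_eq_zero_add
  rw [Nat.cast_zero, Real.zero_rpow (by linarith)] at h4
  push_cast at h4
  have h5 : ∑' n : ℕ, 1 / ((n:ℝ)) ^ (1 + x) ≤ 1 + 1 / x := by
    rw [h4]
    have : 0 ≤ (1 + x) * ZetaAsymptotics.termTSum (1 + x) := by positivity
    rw [add_sub_cancel_left] at h2
    simp only [div_zero, zero_add]
    linarith
  have h6 : 1 + 1 / x ≤ 2 / x := by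
    rw [le_div_iff₀ hx]; field_simp; linarith
  refine le_trans ?_ (h5.trans h6)
  refine tsum_of_norm_bounded h1.hasSum fun n => ?_
  have := aux_term (1 : DirichletCharacter ℂ q) (1 + x) n
  push_cast at this ⊢
  rw [this]
  rw [norm_mul]
  refine (mul_le_of_le_one_right (by positivity) (DirichletCharacter.norm_le_one _ _)).trans ?_
  have e : (1:ℂ) / (((n:ℝ) ^ (1 + x) : ℝ) : ℂ) = ((1 / (n:ℝ) ^ (1 + x) : ℝ) : ℂ) := by push_cast; rfl
  rw [e, Complex.norm_real, Real.norm_of_nonneg (by positivity)]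


open DirichletCharacter in
lemma aux_complex {q : ℕ} [Fact q.Prime] (χ : DirichletCharacter ℂ q) (hχ : χ ≠ 1) (hχ2 : χ ^ 2 ≠ 1)
    (hq3 : 3 ≤ q) (B : ℝ) (hB : B = (2 + Real.log q) ^ 2) (σ : ℝ) (hσ : 0 < σ) (hσ' : σ ≤ 1 / (128 * B ^ 5)) :
    ‖deriv (LFunction χ) ((1 + σ : ℝ) : ℂ) / LFunction χ ((1 + σ : ℝ) : ℂ)‖ ≤ 128 * B ^ 5 := by
  have hq1 : (1:ℝ) ≤ q := by exact_mod_cast (by omega : 1 ≤ q)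
  have hl := Real.log_nonneg hq1
  have hB1 : 1 ≤ B := by rw [hB]; nlinarith
  have hNe : NeZero q := ⟨by omega⟩
  set η := 1 / (128 * B ^ 5) with hη
  have hη0 : 0 < η := by positivity
  have hη1 : η ≤ 1 := by
    rw [hη, div_le_one (by positivity)]
    have := one_le_pow₀ hB1 (n := 5)
    linarith
  have hηB : 128 * η * B ^ 5 = 1 := by rw [hη]; field_simp
  have h := norm_LFunction_product_ge_one χ hη0 0
  simp only [Complex.ofReal_zero, mul_zero, add_zero, norm_mul, norm_pow] at h
  have hz := aux_zeta (q := q) η hη0 hη1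
  have h2 := aux_L (χ ^ 2) hχ2 (1 + η) (by linarith)
  rw [← hB] at h2
  push_cast at h2
  set l := ‖LFunction χ (1 + η)‖ with hl'
  have hl1 : 2 * η * B ≤ l := by
    by_contra hlt
    push Not at hlt
    have hl0 : 0 ≤ l := norm_nonneg _
    have : (2 / η) ^ 3 * l ^ 4 * B < 1 := by
      have h4 : l ^ 4 < (2 * η * B) ^ 4 := pow_lt_pow_left₀ hlt hl0 (by norm_num)
      have : (2 / η) ^ 3 * (2 * η * B) ^ 4 * B = 1 := by
        rw [← hηB]; field_simp; ring
      rw [← this]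
      gcongr
    have h5 : ‖LFunctionTrivChar q (1 + ↑η)‖ ^ 3 * l ^ 4 * ‖LFunction (χ ^ 2) (1 + ↑η)‖ ≤ (2 / η) ^ 3 * l ^ 4 * B := by
      gcongr
    linarith
  have hm := aux_mvt χ hχ hq3 (1 + σ) (1 + η) (by linarith) (by linarith)
  rw [← hB] at hm
  have h3 := aux_L' χ hχ hq3 (1 + σ) (by linarith)
  rw [← hB] at h3
  have hm2 := norm_sub_norm_le (LFunction χ ((1 + η : ℝ) : ℂ)) (LFunction χ ((1 + σ : ℝ) : ℂ))
  have e : ‖LFunction χ ((1 + η : ℝ) : ℂ)‖ = l := by rw [hl']; push_cast; rfl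
  rw [e] at hm2
  have hlow : η * B ≤ ‖LFunction χ ((1 + σ : ℝ) : ℂ)‖ := by nlinarith
  rw [norm_div, div_le_iff₀ (lt_of_lt_of_le (by positivity) hlow)]
  calc _ ≤ B := h3
    _ = 128 * B ^ 5 * (η * B) := by linear_combination (-B) * hηB
    _ ≤ _ := by gcongr

open Finset in
lemma aux_L1 {q : ℕ} [Fact q.Prime] (χ : DirichletCharacter ℂ q) (hχ : χ ≠ 1) (S : ℝ)
    (hS : ∀ N n : ℕ, ‖∑ i ∈ range n, χ ((N + i : ℕ) : ZMod q)‖ ≤ S)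
    (N : ℕ) (hN : 1 ≤ N) :
    ‖DirichletCharacter.LFunction χ 1 - ∑ n ∈ range N, ((1 / (n:ℝ) : ℝ) : ℂ) * χ (n : ZMod q)‖
      ≤ S * (1 / (N:ℝ)) := by
  have hd := (DirichletCharacter.differentiable_LFunction hχ).continuous
  have hN0 : (N:ℝ) ≠ 0 := by exact_mod_cast (by omega : N ≠ 0)
  have hc : Filter.Tendsto (fun s : ℝ => ‖DirichletCharacter.LFunction χ s - ∑ n ∈ range N, ((1 / (n:ℝ) ^ s : ℝ) : ℂ) * χ (n : ZMod q)‖)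
    (nhdsWithin 1 (Set.Ioi 1)) (nhds ‖DirichletCharacter.LFunction χ 1 - ∑ n ∈ range N, ((1 / (n:ℝ) : ℝ) : ℂ) * χ (n : ZMod q)‖) := by
    refine Filter.Tendsto.norm (Filter.Tendsto.sub ?_ ?_)
    · have := ((hd.comp Complex.continuous_ofReal).tendsto 1).mono_left (nhdsWithin_le_nhds (s := Set.Ioi 1))
      simpa [Function.comp_def] using this
    · refine tendsto_finsetSum _ fun n _ => ?_
      refine Filter.Tendsto.mul_const _ ?_
      refine (Complex.continuous_ofReal.tendsto _).comp ?_
      refine Filter.Tendsto.mono_left ?_ nhdsWithin_le_nhds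
      rcases Nat.eq_zero_or_pos n with rfl | hn
      · refine Filter.Tendsto.congr' (f₁ := fun _ => (0:ℝ)) ?_ (by simp)
        filter_upwards [lt_mem_nhds (show (0:ℝ) < 1 by norm_num)] with s hs
        simp [Real.zero_rpow hs.ne']
      · have hn' : (0:ℝ) < n := by exact_mod_cast hn
        have : ContinuousAt (fun s : ℝ => 1 / (n:ℝ) ^ s) 1 := by
          refine ContinuousAt.div continuousAt_const ?_ (by positivity)
          exact (Real.continuous_const_rpow hn'.ne').continuousAt
        simpa [ContinuousAt] using this
  have hc2 : Filter.Tendsto (fun s : ℝ => S * (1 / (N:ℝ) ^ s)) (nhdsWithin 1 (Set.Ioi 1)) (nhds (S * (1 / (N:ℝ)))) := by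
    refine Filter.Tendsto.mono_left ?_ nhdsWithin_le_nhds
    have : ContinuousAt (fun s : ℝ => S * (1 / (N:ℝ) ^ s)) 1 := by
      refine ContinuousAt.mul continuousAt_const (ContinuousAt.div continuousAt_const ?_ (by positivity))
      exact (Real.continuous_const_rpow hN0).continuousAt
    simpa [ContinuousAt] using this
  refine le_of_tendsto_of_tendsto hc hc2 ?_
  filter_upwards [self_mem_nhdsWithin] with s hs
  exact aux_Ltail χ S hS s hs N hN

lemma aux_zm {q : ℕ} (χ : DirichletCharacter ℂ q) (n : ℕ) :
    DirichletCharacter.zetaMul χ n = ∑ i ∈ n.divisors, χ (i : ZMod q) := by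
  rw [DirichletCharacter.zetaMul, ArithmeticFunction.coe_zeta_mul_apply]
  refine Finset.sum_congr rfl fun i hi => ?_
  exact (χ.apply_eq_toArithmeticFunction_apply (Nat.pos_of_mem_divisors hi).ne').symm

open scoped ComplexOrder in
lemma aux_sq {q : ℕ} [Fact q.Prime] (χ : DirichletCharacter ℂ q) (hχ : χ ^ 2 = 1) (m : ℕ) (hm : m ≠ 0) :
    1 ≤ DirichletCharacter.zetaMul χ (m ^ 2) := by
  have hm2 : m ^ 2 ≠ 0 := by positivity
  rw [χ.isMultiplicative_zetaMul.multiplicative_factorization _ hm2]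
  rw [Finsupp.prod]
  refine Finset.prod_induction _ (fun z : ℂ => 1 ≤ z) (fun a b ha hb => ?_) le_rfl ?_
  · exact one_le_mul_of_one_le_of_one_le ha hb
  · intro p hp
    have hp' : p.Prime := Nat.prime_of_mem_primeFactors (by simpa using hp)
    rw [Nat.factorization_pow]
    simp only [Finsupp.smul_apply, smul_eq_mul]
    set k := m.factorization p
    rw [aux_zm, Nat.sum_divisors_prime_pow hp']
    simp only [Nat.cast_pow, map_pow]
    rcases MulChar.isQuadratic_iff_sq_eq_one.mpr hχ p with h | h | h
    · rw [h, Finset.sum_range_succ']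
      simp
    · rw [h]; simp only [one_pow, Finset.sum_const, Finset.card_range, nsmul_eq_mul, mul_one]
      exact_mod_cast Nat.le_add_left 1 (2 * k)
    · rw [h, neg_one_geom_sum]
      rw [if_neg (by simp)]



open Finset in
lemma aux_geom (z : ℝ) (hz : 0 < z) (n : ℕ) : ((n:ℝ) * Real.sqrt z ^ (n - 1)) ^ 2 ≤ (∑ i ∈ range n, z ^ i) ^ 2 := by
  have h := Finset.sum_sq_le_sum_mul_sum_of_sq_le_mul (range n) (r := fun _ => Real.sqrt z ^ (n-1))
    (f := fun i => z ^ i) (g := fun i => z ^ (n - 1 - i)) (fun i _ => by positivity) (fun i _ => by positivity) ?_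
  · rw [Finset.sum_range_reflect (fun i => z ^ i)] at h
    simpa [sq] using h
  · intro i hi
    have := mem_range.mp hi
    rw [← pow_mul, mul_comm, pow_mul, Real.sq_sqrt hz.le, ← pow_add]
    refine le_of_eq ?_
    congr 1; omega

open Finset in
lemma aux_b (z : ℝ) (hz : 0 < z) (hz1 : z < 1) :
    Antitone (fun i : ℕ => 1 / (((i + 1 : ℕ):ℝ) * (1 - z)) - z ^ (i+1) / (1 - z ^ (i+1))) ∧
    ∀ i : ℕ, 0 ≤ 1 / (((i + 1 : ℕ):ℝ) * (1 - z)) - z ^ (i+1) / (1 - z ^ (i+1)) := by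
  have h1 : 0 < 1 - z := by linarith
  have hG : ∀ n : ℕ, 1 - z ^ n = (1 - z) * ∑ i ∈ range n, z ^ i := fun n => (mul_neg_geom_sum z n).symm
  have hGp : ∀ n : ℕ, 0 < ∑ i ∈ range (n+1), z ^ i := fun n =>
    Finset.sum_pos (fun i _ => by positivity) (by simp)
  constructor
  · refine antitone_nat_of_succ_le fun n => ?_
    have e1 := aux_geom z hz (n+1)
    have e2 := aux_geom z hz (n+2)
    have g1 := hGp n
    have g2 := hGp (n+1)
    have hs0 : 0 < Real.sqrt z := Real.sqrt_pos.mpr hz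
    have hs1 : Real.sqrt z ≤ 1 := Real.sqrt_le_one.mpr hz1.le
    have e1' := le_of_abs_le (abs_le_of_sq_le_sq e1 g1.le)
    have e2' := le_of_abs_le (abs_le_of_sq_le_sq e2 g2.le)
    simp only [Nat.add_sub_cancel, show n + 2 - 1 = n + 1 by omega] at e1' e2'
    have hz2 : z ^ (n+1) ≤ Real.sqrt z ^ n * Real.sqrt z ^ (n+1) := by
      conv_lhs => rw [← Real.sq_sqrt hz.le]
      rw [← pow_mul, ← pow_add]
      exact pow_le_pow_of_le_one hs0.le hs1 (by omega)
    have key : ((n+1:ℕ):ℝ) * ((n+2:ℕ):ℝ) * z ^ (n+1) ≤ (∑ i ∈ range (n+1), z ^ i) * (∑ i ∈ range (n+2), z ^ i) := by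
      calc ((n+1:ℕ):ℝ) * ((n+2:ℕ):ℝ) * z ^ (n+1) ≤ ((n+1:ℕ):ℝ) * ((n+2:ℕ):ℝ) * (Real.sqrt z ^ n * Real.sqrt z ^ (n+1)) := by gcongr
        _ = (((n+1:ℕ):ℝ) * Real.sqrt z ^ n) * (((n+2:ℕ):ℝ) * Real.sqrt z ^ (n+1)) := by ring
        _ ≤ _ := by gcongr
    simp only [show n + 1 + 1 = n + 2 by omega]
    have hh1 := hG (n+1)
    have hh2 := hG (n+2)
    set G1 := ∑ i ∈ range (n+1), z ^ i
    set G2 := ∑ i ∈ range (n+2), z ^ i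
    have hz12 : z ^ (n+2) = z ^ (n+1) * z := by ring
    have p1 : 0 < 1 - z ^ (n+1) := by rw [hh1]; positivity
    have p2 : 0 < 1 - z ^ (n+2) := by rw [hh2]; positivity
    have d1 : z ^ (n+1) / (1 - z ^ (n+1)) - z ^ (n+2) / (1 - z ^ (n+2)) = z ^ (n+1) / ((1 - z) * (G1 * G2)) := by
      have : z ^ (n+1) / (1 - z ^ (n+1)) - z ^ (n+2) / (1 - z ^ (n+2)) = z ^ (n+1) * (1 - z) / ((1 - z ^ (n+1)) * (1 - z ^ (n+2))) := by
        field_simp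
        ring
      rw [this, hh1, hh2]
      field_simp
    have d2 : 1 / (((n+1:ℕ):ℝ) * (1 - z)) - 1 / (((n+2:ℕ):ℝ) * (1 - z)) = 1 / ((1 - z) * (((n+1:ℕ):ℝ) * ((n+2:ℕ):ℝ))) := by
      push_cast
      field_simp
      ring
    have : z ^ (n+1) / ((1 - z) * (G1 * G2)) ≤ 1 / ((1 - z) * (((n+1:ℕ):ℝ) * ((n+2:ℕ):ℝ))) := by
      rw [div_le_div_iff₀ (by positivity) (by positivity)]
      nlinarith
    linarith
  · intro n
    have g1 := hGp n
    rw [hG, sub_nonneg, div_le_div_iff₀ (by positivity) (by positivity)]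
    have : ((n+1:ℕ):ℝ) * z ^ (n+1) ≤ ∑ i ∈ range (n+1), z ^ i := by
      have := Finset.card_nsmul_le_sum (range (n+1)) (fun i => z ^ i) (z ^ (n+1)) (fun i hi => by
        exact pow_le_pow_of_le_one hz.le hz1.le (mem_range.mp hi).le)
      simpa using this
    nlinarith

lemma aux_lambert {q : ℕ} (χ : DirichletCharacter ℂ q) (z : ℝ) (hz : 0 < z) (hz1 : z < 1) :
    ∃ T : ℂ, HasSum (fun n : ℕ+ => ((z ^ (n:ℕ) / (1 - z ^ (n:ℕ)) : ℝ) : ℂ) * χ ((n:ℕ) : ZMod q)) T ∧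
      HasSum (fun m : ℕ+ => DirichletCharacter.zetaMul χ (m:ℕ) * ((z ^ (m:ℕ) : ℝ) : ℂ)) T := by
  have hs : Summable (fun c : ℕ+ × ℕ+ => χ ((c.1:ℕ) : ZMod q) * ((z ^ (c.1 * c.2 : ℕ) : ℝ) : ℂ)) := by
    have h0 := summable_prod_mul_pow (𝕜 := ℝ) 0 (r := z) (by rw [Real.norm_of_nonneg hz.le]; exact hz1)
    refine Summable.of_norm_bounded h0 fun c => ?_
    rw [norm_mul, Complex.norm_real, Real.norm_of_nonneg (by positivity)]
    simp only [pow_zero, one_mul]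
    exact mul_le_of_le_one_left (by positivity) (DirichletCharacter.norm_le_one χ _)
  refine ⟨_, hs.hasSum.prod_fiberwise fun n => ?_, ?_⟩
  · have hg : HasSum (fun k : ℕ => z ^ (n:ℕ) * (z ^ (n:ℕ)) ^ k) (z ^ (n:ℕ) * (1 - z ^ (n:ℕ))⁻¹) :=
      (hasSum_geometric_of_lt_one (by positivity) (pow_lt_one₀ hz.le hz1 n.ne_zero)).mul_left _
    have hg2 : HasSum (fun k : ℕ+ => z ^ (n * k : ℕ)) (z ^ (n:ℕ) * (1 - z ^ (n:ℕ))⁻¹) := by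
      rw [← Equiv.pnatEquivNat.symm.hasSum_iff]
      convert hg using 2 with k
      simp [← pow_mul, ← pow_add, Nat.mul_succ, add_comm]
    have := (Complex.hasSum_ofReal.mpr hg2).mul_left (χ ((n:ℕ) : ZMod q))
    rw [mul_comm]
    exact this
  · have h2 := (sigmaAntidiagonalEquivProd.hasSum_iff.mpr hs.hasSum).sigma (g := fun m : ℕ+ => DirichletCharacter.zetaMul χ (m:ℕ) * ((z ^ (m:ℕ) : ℝ) : ℂ)) ?_
    · exact h2
    intro m
    have e : DirichletCharacter.zetaMul χ (m:ℕ) * ((z ^ (m:ℕ) : ℝ) : ℂ) =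
      ∑ c : Nat.divisorsAntidiagonal m, χ ((c.1.1:ℕ) : ZMod q) * ((z ^ (c.1.1 * c.1.2 : ℕ) : ℝ) : ℂ) := by
      rw [Finset.sum_coe_sort (Nat.divisorsAntidiagonal m) (fun c => χ ((c.1:ℕ) : ZMod q) * ((z ^ (c.1 * c.2 : ℕ) : ℝ) : ℂ)),
        Nat.sum_divisorsAntidiagonal (fun a b => χ ((a:ℕ) : ZMod q) * ((z ^ (a * b : ℕ) : ℝ) : ℂ)), aux_zm, Finset.sum_mul]
      refine Finset.sum_congr rfl fun i hi => ?_
      rw [Nat.mul_div_cancel' (Nat.dvd_of_mem_divisors hi)]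
    rw [e]
    exact hasSum_fintype _

open Finset Filter in
lemma aux_main4 {q : ℕ} [Fact q.Prime] (χ : DirichletCharacter ℂ q) (hχ : χ ≠ 1) (S : ℝ)
    (hS : ∀ N n : ℕ, ‖∑ i ∈ range n, χ ((N + i : ℕ) : ZMod q)‖ ≤ S)
    (z : ℝ) (hz : 0 < z) (hz1 : z < 1) (T : ℂ)
    (hT : HasSum (fun n : ℕ+ => ((z ^ (n:ℕ) / (1 - z ^ (n:ℕ)) : ℝ) : ℂ) * χ ((n:ℕ) : ZMod q)) T) :
    ‖((1 / (1 - z) : ℝ) : ℂ) * DirichletCharacter.LFunction χ 1 - T‖ ≤ S := by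
  obtain ⟨hb, hb0⟩ := aux_b z hz hz1
  have h1 := fun M => aux_abel (fun i => χ ((1 + i : ℕ) : ZMod q)) _ hb hb0 S (hS 1) M
  have hb1 : 1 / (((0 + 1 : ℕ):ℝ) * (1 - z)) - z ^ (0+1) / (1 - z ^ (0+1)) = 1 := by
    have : 1 - z ≠ 0 := by linarith
    simp
    field_simp
  rw [hb1, mul_one] at h1
  have hA : Tendsto (fun M : ℕ => ∑ n ∈ range M, ((1 / (n:ℝ) : ℝ) : ℂ) * χ (n : ZMod q)) atTop (nhds (DirichletCharacter.LFunction χ 1)) := by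
    rw [tendsto_iff_norm_sub_tendsto_zero]
    have h0 : Tendsto (fun N : ℕ => S * (1 / (N:ℝ))) atTop (nhds 0) := by
      simpa using tendsto_one_div_atTop_nhds_zero_nat.const_mul S
    refine squeeze_zero' (Eventually.of_forall fun _ => norm_nonneg _) ?_ h0
    filter_upwards [eventually_ge_atTop 1] with N hN
    rw [norm_sub_rev]
    exact aux_L1 χ hχ S hS N hN
  have hA' := ((tendsto_add_atTop_iff_nat 1).mpr hA).const_mul ((1 / (1 - z) : ℝ) : ℂ)
  have hT2 : HasSum (fun i : ℕ => ((z ^ (i+1) / (1 - z ^ (i+1)) : ℝ) : ℂ) * χ ((1 + i : ℕ) : ZMod q)) T := by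
    rw [← Equiv.pnatEquivNat.symm.hasSum_iff] at hT
    convert hT using 2 with k
    simp [add_comm]
  have hC := (hA'.sub hT2.tendsto_sum_nat).norm
  refine le_of_tendsto hC (Eventually.of_forall fun M => ?_)
  refine le_of_eq_of_le ?_ (h1 M)
  congr 1
  rw [sum_range_succ', mul_add, mul_sum]
  simp only [Nat.cast_zero, div_zero, Complex.ofReal_zero, zero_mul, mul_zero, add_zero]
  rw [← sum_sub_distrib]
  refine sum_congr rfl fun i _ => ?_
  rw [add_comm 1 i, ← mul_assoc, ← sub_mul]
  congr 1
  push_cast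
  rw [one_div_mul_one_div_rev]

open Finset in
lemma aux_L1low {q : ℕ} [Fact q.Prime] (χ : DirichletCharacter ℂ q) (hχ : χ ≠ 1) (hχ2 : χ ^ 2 = 1) (S : ℝ)
    (hS1 : 1 ≤ S)
    (hS : ∀ N n : ℕ, ‖∑ i ∈ range n, χ ((N + i : ℕ) : ZMod q)‖ ≤ S) :
    1 / (40 * S) ≤ ‖DirichletCharacter.LFunction χ 1‖ := by
  obtain ⟨M, hM⟩ : ∃ M : ℕ, M = ⌈4 * S⌉₊ := ⟨_, rfl⟩
  have hM1 : 4 * S ≤ M := by rw [hM]; exact Nat.le_ceil _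
  have hM2 : (M:ℝ) ≤ 5 * S := by
    have := Nat.ceil_lt_add_one (show 0 ≤ 4 * S by linarith)
    rw [hM]; linarith
  have hM0 : (1:ℝ) ≤ M := by linarith
  set z : ℝ := 1 - 1 / (2 * (M:ℝ)^2) with hzdef
  have hw : 1 / (2 * (M:ℝ)^2) ≤ 1 / 2 := by
    rw [div_le_div_iff₀ (by positivity) (by norm_num)]; nlinarith
  have hw0 : 0 < 1 / (2 * (M:ℝ)^2) := by positivity
  have hz : 0 < z := by linarith
  have hz1 : z < 1 := by linarith
  obtain ⟨T, hT1, hT2⟩ := aux_lambert χ z hz hz1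
  have h4 := aux_main4 χ hχ S hS z hz hz1 T hT1
  have hre : ∀ m : ℕ, 0 ≤ (DirichletCharacter.zetaMul χ m).re := fun m =>
    (Complex.le_def.mp (DirichletCharacter.zetaMul_nonneg hχ2 m)).1
  have hre2 : ∀ m : ℕ, m ≠ 0 → 1 ≤ (DirichletCharacter.zetaMul χ (m^2)).re := fun m hm =>
    (Complex.le_def.mp (aux_sq χ hχ2 m hm)).1
  have hT3 := Complex.hasSum_re hT2
  have hTlow : (M:ℝ) / 2 ≤ T.re := by
    have := sum_le_hasSum ((range M).image (fun m => (Nat.succPNat m) ^ 2)) (fun m _ => ?_) hT3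
    · refine le_trans ?_ this
      rw [sum_image]
      · have := Finset.card_nsmul_le_sum (range M) (fun m => (DirichletCharacter.zetaMul χ (((Nat.succPNat m) ^ 2 : ℕ+) : ℕ) * ((z ^ (((Nat.succPNat m) ^ 2 : ℕ+):ℕ) : ℝ) : ℂ)).re) (1/2) ?_
        · simpa [div_eq_mul_inv] using this
        · intro m hm
          have hm' := mem_range.mp hm
          rw [Complex.re_mul_ofReal]
          simp only [PNat.pow_coe, Nat.succPNat_coe]
          have a1 := hre2 (m+1) (by omega)
          have a2 : 1 / 2 ≤ z ^ ((m+1)^2) := by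
            have := one_add_mul_le_pow (a := - (1 / (2 * (M:ℝ)^2))) (by linarith) ((m+1)^2)
            have hm3 : (((m+1)^2 : ℕ) : ℝ) ≤ (M:ℝ)^2 := by
              exact_mod_cast Nat.pow_le_pow_left (by omega : m + 1 ≤ M) 2
            have : (((m+1)^2 : ℕ) : ℝ) * (1 / (2 * (M:ℝ)^2)) ≤ 1 / 2 := by
              rw [mul_one_div, div_le_div_iff₀ (by positivity) (by norm_num)]; linarith
            rw [hzdef, sub_eq_add_neg]
            linarith
          simp only [Nat.succ_eq_add_one]
          nlinarith
      · intro a _ b _ hab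
        have := congrArg PNat.val hab
        simp only [PNat.pow_coe, Nat.succPNat_coe] at this
        have := Nat.pow_left_injective (n := 2) (by norm_num) this
        simpa using this
    · rw [Complex.re_mul_ofReal]
      exact mul_nonneg (hre _) (by positivity)
  have hzz : 1 / (1 - z) = 2 * (M:ℝ)^2 := by rw [hzdef]; simp
  rw [hzz] at h4
  have h5 : ‖T‖ ≤ 2 * (M:ℝ)^2 * ‖DirichletCharacter.LFunction χ 1‖ + S := by
    have := norm_sub_norm_le T (((2 * (M:ℝ)^2 : ℝ) : ℂ) * DirichletCharacter.LFunction χ 1)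
    rw [norm_sub_rev, norm_mul, Complex.norm_real, Real.norm_of_nonneg (by positivity)] at this
    linarith
  have h6 := Complex.re_le_norm T
  have h7 : (M:ℝ) / 4 ≤ 2 * (M:ℝ)^2 * ‖DirichletCharacter.LFunction χ 1‖ := by linarith
  have h8 : 1 ≤ 8 * M * ‖DirichletCharacter.LFunction χ 1‖ := by
    have : (M:ℝ) * 1 ≤ M * (8 * M * ‖DirichletCharacter.LFunction χ 1‖) := by nlinarith
    exact le_of_mul_le_mul_left this (by linarith)
  rw [div_le_iff₀ (by positivity)]
  have : 8 * M * ‖DirichletCharacter.LFunction χ 1‖ ≤ 8 * (5 * S) * ‖DirichletCharacter.LFunction χ 1‖ := by gcongr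
  linarith

/-- bound for the logarithmic derivative of a quadratic character. -/
lemma aux_quad {q : ℕ} [Fact q.Prime] (χ : DirichletCharacter ℂ q) (hχ : χ ≠ 1) (hχ2 : χ ^ 2 = 1)
    (hq3 : 3 ≤ q) (B : ℝ) (hB : B = (2 + Real.log q) ^ 2) (σ : ℝ) (hσ : 0 < σ)
    (hσ' : σ * B ≤ 1 / (400 * (q:ℝ) ^ (3/4:ℝ))) :
    ‖deriv (DirichletCharacter.LFunction χ) ((1 + σ : ℝ) : ℂ) / DirichletCharacter.LFunction χ ((1 + σ : ℝ) : ℂ)‖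
      ≤ 400 * (q:ℝ) ^ (3/4:ℝ) * B := by
  have hq1 : (1:ℝ) ≤ q := by exact_mod_cast (by omega : 1 ≤ q)
  have hQ : 1 ≤ (q:ℝ) ^ (3/4:ℝ) := Real.one_le_rpow hq1 (by norm_num)
  have hl := aux_L1low χ hχ hχ2 (5 * (q:ℝ) ^ (3/4:ℝ)) (by linarith) (fun N n => aux_pv' χ hχ N n)
  have hm := aux_mvt χ hχ hq3 1 (1 + σ) le_rfl (by linarith)
  rw [← hB] at hm
  have h3 := aux_L' χ hχ hq3 (1 + σ) (by linarith)
  rw [← hB] at h3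
  have hm2 := norm_sub_norm_le (DirichletCharacter.LFunction χ ((1 : ℝ) : ℂ)) (DirichletCharacter.LFunction χ ((1 + σ : ℝ) : ℂ))
  rw [norm_sub_rev] at hm2
  rw [Complex.ofReal_one] at hm hm2
  set Q := (q:ℝ) ^ (3/4:ℝ)
  have e : 1 / (40 * (5 * Q)) = 1 / (400 * Q) + 1 / (400 * Q) := by field_simp; norm_num
  have hlow : 1 / (400 * Q) ≤ ‖DirichletCharacter.LFunction χ ((1 + σ : ℝ) : ℂ)‖ := by
    rw [e] at hl; nlinarith
  have hB0 : 0 ≤ B := by rw [hB]; positivity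
  rw [norm_div, div_le_iff₀ (lt_of_lt_of_le (by positivity) hlow)]
  calc _ ≤ B := h3
    _ = 400 * Q * B * (1 / (400 * Q)) := by field_simp
    _ ≤ _ := by gcongr


open Finset in
lemma aux_parseval {q : ℕ} [Fact q.Prime] (c : DirichletCharacter ℂ q → ℂ) :
    ∑ a : ZMod q, ‖∑ χ : DirichletCharacter ℂ q, c χ * χ a⁻¹‖ ^ 2 = ((q:ℝ) - 1) * ∑ χ : DirichletCharacter ℂ q, ‖c χ‖ ^ 2 := by
  classical
  have hq1 : 1 ≤ q := (Fact.out : q.Prime).one_lt.le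
  rw [show ∑ a : ZMod q, ‖∑ χ : DirichletCharacter ℂ q, c χ * χ a⁻¹‖ ^ 2 = ∑ a : ZMod q, ‖∑ χ : DirichletCharacter ℂ q, c χ * χ a‖ ^ 2 from
    Equiv.sum_comp (Equiv.inv (ZMod q)) (fun a => ‖∑ χ : DirichletCharacter ℂ q, c χ * χ a‖ ^ 2)]
  have horth : ∀ χ ψ : DirichletCharacter ℂ q, ∑ a : ZMod q, χ a * star (ψ a) = if χ = ψ then ((q:ℂ) - 1) else 0 := by
    intro χ ψ
    have : ∑ a : ZMod q, χ a * star (ψ a) = ∑ a : ZMod q, (χ * ψ⁻¹) a :=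
      sum_congr rfl fun a _ => by rw [MulChar.star_apply', MulChar.mul_apply]
    rw [this]
    split_ifs with h
    · rw [h, mul_inv_cancel, MulChar.sum_one_eq_card_units, ZMod.card_units_eq_totient, Nat.totient_prime Fact.out]
      push_cast [hq1]; rfl
    · exact MulChar.sum_eq_zero_of_ne_one (fun h' => h (mul_inv_eq_one.mp h'))
  apply Complex.ofReal_injective
  push_cast
  simp_rw [← Complex.mul_conj']
  calc ∑ a : ZMod q, (∑ χ : DirichletCharacter ℂ q, c χ * χ a) * (starRingEnd ℂ) (∑ χ : DirichletCharacter ℂ q, c χ * χ a)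
      = ∑ a : ZMod q, ∑ χ : DirichletCharacter ℂ q, ∑ ψ : DirichletCharacter ℂ q, (c χ * (starRingEnd ℂ) (c ψ)) * (χ a * star (ψ a)) := by
        refine sum_congr rfl fun a _ => ?_
        rw [map_sum, sum_mul_sum]
        refine sum_congr rfl fun χ _ => sum_congr rfl fun ψ _ => ?_
        rw [map_mul, Complex.star_def]; ring
    _ = ∑ χ : DirichletCharacter ℂ q, ∑ ψ : DirichletCharacter ℂ q, (c χ * (starRingEnd ℂ) (c ψ)) * ∑ a : ZMod q, (χ a * star (ψ a)) := by
        rw [sum_comm]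
        refine sum_congr rfl fun χ _ => ?_
        rw [sum_comm]
        refine sum_congr rfl fun ψ _ => ?_
        rw [mul_sum]
    _ = _ := by
        simp_rw [horth]
        rw [mul_sum]
        refine sum_congr rfl fun χ _ => ?_
        simp
        ring

open Finset in
lemma aux_quadcard {q : ℕ} [Fact q.Prime] [DecidableEq (DirichletCharacter ℂ q)] :
    (univ.filter fun χ : DirichletCharacter ℂ q => χ ^ 2 = 1).card ≤ 2 := by
  obtain ⟨g, hg⟩ := IsCyclic.exists_generator (α := (ZMod q)ˣ)
  have := Finset.card_le_card_of_injOn (s := univ.filter fun χ : DirichletCharacter ℂ q => χ ^ 2 = 1) (t := ({1, -1} : Finset ℂ)) (fun χ => χ g.val) ?_ ?_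
  · exact this.trans (Finset.card_le_two)
  · intro χ hχ
    have hχ2 : χ ^ 2 = 1 := by simpa using hχ
    have h1 : (χ g.val) ^ 2 = 1 := by
      rw [← MulChar.pow_apply_coe, hχ2, MulChar.one_apply_coe]
    simpa using mul_self_eq_one_iff.mp (by rw [← sq]; exact h1)
  · intro χ _ ψ _ h
    exact (MulChar.eq_iff hg χ ψ).mpr h

open ArithmeticFunction vonMangoldt in
lemma aux_FR {q : ℕ} (a : ZMod q) (s : ℝ) :
    ((∑' n : ℕ, residueClass a n / (n:ℝ) ^ s : ℝ) : ℂ) = LSeries (fun n => (residueClass a n : ℂ)) s := by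
  simp only [Complex.ofReal_tsum, Complex.ofReal_div, Complex.ofReal_cpow (Nat.cast_nonneg _), Complex.ofReal_natCast,
      LSeries, LSeries.term]
  refine tsum_congr fun n ↦ ?_
  split_ifs with hn
  · simp only [hn, residueClass_apply_zero, Complex.ofReal_zero, zero_div]
  · rfl

open ArithmeticFunction vonMangoldt Finset in
lemma aux_dev {q : ℕ} [Fact q.Prime] (hq3 : 3 ≤ q) (B : ℝ) (hB : B = (2 + Real.log q) ^ 2) (σ : ℝ) (hσ : 0 < σ)
    (hσ1 : σ ≤ 1 / (128 * B ^ 5))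
    (hσ2 : σ * B ≤ 1 / (400 * (q:ℝ) ^ (3/4:ℝ))) :
    ∃ m : ℝ, ∃ e : ZMod q → ℝ, (∀ a, 0 ≤ e a) ∧
      (∀ a : ZMod q, a ≠ 0 → |∑' n : ℕ, residueClass a n / (n:ℝ) ^ (1 + σ) - m| ≤ e a) ∧
      ∑ a, e a ≤ 900 * (q:ℝ) ^ (3/4:ℝ) * B ^ 5 := by
  classical
  have hq1 : (1:ℝ) ≤ q := by exact_mod_cast (by omega : 1 ≤ q)
  have hq3' : (3:ℝ) ≤ q := by exact_mod_cast hq3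
  have hl := Real.log_nonneg hq1
  have hB1 : 1 ≤ B := by rw [hB]; nlinarith
  set Q := (q:ℝ) ^ (3/4:ℝ) with hQdef
  have hQ : 1 ≤ Q := Real.one_le_rpow hq1 (by norm_num)
  set s : ℂ := ((1 + σ : ℝ) : ℂ) with hs
  set ℓ : DirichletCharacter ℂ q → ℂ := fun χ => deriv (DirichletCharacter.LFunction χ) s / DirichletCharacter.LFunction χ s with hℓ
  set f : ℝ := (q:ℝ) - 1 with hf
  have hf0 : 2 ≤ f := by linarith
  have htot : (q.totient : ℂ) = (f : ℂ) := by
    rw [Nat.totient_prime Fact.out, hf]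
    push_cast [show 1 ≤ q by omega]; rfl
  set c : DirichletCharacter ℂ q → ℂ := fun χ => if χ = 1 then 0 else -(f:ℂ)⁻¹ * ℓ χ with hc
  refine ⟨(-(f:ℂ)⁻¹ * ℓ 1).re, fun a => ‖∑ χ : DirichletCharacter ℂ q, c χ * χ a⁻¹‖, fun a => norm_nonneg _, ?_, ?_⟩
  · intro a ha
    have hu : IsUnit a := ha.isUnit
    have h := LSeries_residueClass_eq hu (s := s) (by simp [hs, hσ])
    rw [← aux_FR, htot] at h
    have hsplit : -(f:ℂ)⁻¹ * ∑ χ : DirichletCharacter ℂ q, χ a⁻¹ * ℓ χ = -(f:ℂ)⁻¹ * ℓ 1 + ∑ χ : DirichletCharacter ℂ q, c χ * χ a⁻¹ := by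
      rw [Fintype.sum_eq_add_sum_compl 1, Fintype.sum_eq_add_sum_compl 1 (fun χ => c χ * χ a⁻¹), mul_add, mul_sum]
      congr 1
      · rw [MulChar.one_apply (inv_ne_zero ha).isUnit, one_mul]
      · simp only [hc, if_true, zero_mul, zero_add]
        refine sum_congr rfl fun χ hχ => ?_
        rw [if_neg (by simpa using hχ)]; ring
    rw [hsplit] at h
    have h2 := congrArg Complex.re h
    rw [Complex.ofReal_re, Complex.add_re] at h2
    rw [h2, add_sub_cancel_left]
    exact Complex.abs_re_le_norm _
  · have hp := aux_parseval c
    have hcs := sq_sum_le_card_mul_sum_sq (s := (univ : Finset (ZMod q))) (f := fun a => ‖∑ χ : DirichletCharacter ℂ q, c χ * χ a⁻¹‖)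
    rw [hp, card_univ, ZMod.card] at hcs
    have hbd : ∀ χ : DirichletCharacter ℂ q, ‖c χ‖ ^ 2 ≤ f⁻¹ ^ 2 * ((128 * B ^ 5) ^ 2 + if χ ^ 2 = 1 then (400 * Q * B) ^ 2 else 0) := by
      intro χ
      by_cases h1 : χ = 1
      · simp only [hc, h1, if_true, norm_zero]
        rw [zero_pow two_ne_zero]
        positivity
      · simp only [hc, if_neg h1, norm_mul, norm_neg, norm_inv, Complex.norm_real, mul_pow]
        rw [Real.norm_of_nonneg (by linarith : 0 ≤ f)]
        refine mul_le_mul_of_nonneg_left ?_ (by positivity)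
        split_ifs with h2
        · have := aux_quad χ h1 h2 hq3 B hB σ hσ hσ2
          have := pow_le_pow_left₀ (norm_nonneg _) this 2
          calc _ ≤ _ := this
            _ = 400 ^ 2 * Q ^ 2 * B ^ 2 := by ring
            _ ≤ _ := by
              have : 0 ≤ 128 ^ 2 * (B ^ 5) ^ 2 := by positivity
              linarith
        · have := aux_complex χ h1 h2 hq3 B hB σ hσ hσ1
          have := pow_le_pow_left₀ (norm_nonneg _) this 2
          calc _ ≤ _ := this
            _ = _ := by ring
    have hcard : (Fintype.card (DirichletCharacter ℂ q) : ℝ) = f := by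
      have := DirichletCharacter.card_eq_totient_of_hasEnoughRootsOfUnity ℂ q
      rw [Nat.card_eq_fintype_card, Nat.totient_prime Fact.out] at this
      rw [this, hf]
      push_cast [show 1 ≤ q by omega]; rfl
    have hsum : ∑ χ : DirichletCharacter ℂ q, ‖c χ‖ ^ 2 ≤ f⁻¹ ^ 2 * (f * (128 * B ^ 5) ^ 2 + 2 * (400 * Q * B) ^ 2) := by
      refine (sum_le_sum fun χ _ => hbd χ).trans ?_
      rw [← mul_sum]
      refine mul_le_mul_of_nonneg_left ?_ (by positivity)
      rw [sum_add_distrib, sum_const, nsmul_eq_mul, card_univ, hcard, ← sum_filter, sum_const, nsmul_eq_mul]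
      have : ((univ.filter fun χ : DirichletCharacter ℂ q => χ ^ 2 = 1).card : ℝ) ≤ 2 := by exact_mod_cast aux_quadcard
      gcongr
    have hQ2 : (q:ℝ) ≤ Q ^ 2 := by
      rw [hQdef, ← Real.rpow_natCast, ← Real.rpow_mul (by linarith)]
      conv_lhs => rw [← Real.rpow_one (q:ℝ)]
      exact Real.rpow_le_rpow_of_exponent_le hq1 (by norm_num)
    have hqf : (q:ℝ) ≤ 2 * f := by linarith
    have hfin : (q:ℝ) * (f * (f⁻¹ ^ 2 * (f * (128 * B ^ 5) ^ 2 + 2 * (400 * Q * B) ^ 2))) ≤ (900 * Q * B ^ 5) ^ 2 := by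
      have e1 : (q:ℝ) * (f * (f⁻¹ ^ 2 * (f * (128 * B ^ 5) ^ 2 + 2 * (400 * Q * B) ^ 2))) = q * (128 * B ^ 5) ^ 2 + (q / f) * (2 * (400 * Q * B) ^ 2) := by
        field_simp
      have e2 : q / f ≤ 2 := by rw [div_le_iff₀ (by linarith)]; linarith
      have e3 : (400 * Q * B) ^ 2 ≤ (400 * Q * B ^ 5) ^ 2 := by
        have : B ≤ B ^ 5 := le_self_pow₀ hB1 (by norm_num)
        gcongr
      rw [e1]
      calc _ ≤ Q ^ 2 * (128 * B ^ 5) ^ 2 + 2 * (2 * (400 * Q * B ^ 5) ^ 2) := by gcongr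
        _ ≤ _ := by
          have : 0 ≤ Q ^ 2 * (B ^ 5) ^ 2 := by positivity
          nlinarith
    refine le_of_sq_le_sq ?_ (by positivity)
    refine hcs.trans (le_trans ?_ hfin)
    gcongr


open ArithmeticFunction vonMangoldt in
lemma aux_FRsum {q : ℕ} (a : ZMod q) (s : ℝ) (hs : 1 < s) : Summable fun n : ℕ => residueClass a n / (n:ℝ) ^ s :=
  LSeries.summable_real_of_abscissaOfAbsConv_lt <|
        (abscissaOfAbsConv_residueClass_le_one a).trans_lt <| mod_cast hs

open ArithmeticFunction vonMangoldt in
lemma aux_one (a : ZMod 1) (n : ℕ) : residueClass a n = vonMangoldt n := by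
  simp [residueClass, Subsingleton.elim (n : ZMod 1) a]

open ArithmeticFunction vonMangoldt in
lemma aux_Zsum (s : ℝ) (hs : 1 < s) : Summable fun n : ℕ => vonMangoldt n / (n:ℝ) ^ s := by
  have := aux_FRsum (1 : ZMod 1) s hs
  simpa only [aux_one] using this

open ArithmeticFunction vonMangoldt in
lemma aux_Psum : Summable fun n : ℕ => (if n.Prime then 0 else vonMangoldt n) / (n:ℝ) := by
  have := summable_residueClass_non_primes_div (1 : ZMod 1)
  simpa only [aux_one] using this

open ArithmeticFunction vonMangoldt in
lemma aux_Z : ∃ C : ℝ, 0 ≤ C ∧ ∀ s : ℝ, 1 < s → s ≤ 2 → |∑' n : ℕ, vonMangoldt n / (n:ℝ) ^ s - 1 / (s - 1)| ≤ C := by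
  have hu : IsUnit (1 : ZMod 1) := isUnit_one
  have : ContinuousOn (fun x : ℝ ↦ LFunctionResidueClassAux (1 : ZMod 1) x) (Set.Icc 1 2) :=
    (continuousOn_LFunctionResidueClassAux (1 : ZMod 1)).comp Complex.continuous_ofReal.continuousOn fun x hx ↦ by
        simpa only [Set.mem_setOf_eq, Complex.ofReal_re] using hx.1
  obtain ⟨C, hC⟩ := isCompact_Icc.exists_bound_of_continuousOn this
  refine ⟨C, (norm_nonneg _).trans (hC 1 (by simp)), fun s h1 h2 => ?_⟩
  have h := hC s ⟨h1.le, h2⟩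
  rw [eqOn_LFunctionResidueClassAux hu (by simpa using h1)] at h
  beta_reduce at h
  rw [← aux_FR] at h
  simp only [aux_one] at h
  refine le_of_eq_of_le ?_ h
  rw [← Real.norm_eq_abs, ← Complex.norm_real]
  push_cast
  simp

open ArithmeticFunction vonMangoldt Finset in
lemma aux_bad {q : ℕ} [Fact q.Prime] (x σ : ℝ) (hx : 1 ≤ x) (hσ : 0 < σ) (s : Finset (ZMod q))
    (hs : ∀ a ∈ s, ∀ p : ℕ, p.Prime → (p : ZMod q) = a → x < p) :
    ∑ a ∈ s, ∑' n : ℕ, residueClass a n / (n:ℝ) ^ (1 + σ) ≤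
      (∑' n : ℕ, (if n.Prime then 0 else vonMangoldt n) / (n:ℝ)) + x ^ (-(σ/2)) * ∑' n : ℕ, vonMangoldt n / (n:ℝ) ^ (1 + σ / 2) := by
  classical
  rw [← Summable.tsum_finsetSum (fun a _ => aux_FRsum a (1 + σ) (by linarith)), ← tsum_mul_left,
    ← Summable.tsum_add aux_Psum ((aux_Zsum (1 + σ / 2) (by linarith)).mul_left _)]
  refine Summable.tsum_le_tsum (fun n => ?_) (summable_sum fun a _ => aux_FRsum a (1 + σ) (by linarith))
    (aux_Psum.add ((aux_Zsum (1 + σ / 2) (by linarith)).mul_left _))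
  have hΛ : 0 ≤ vonMangoldt n := vonMangoldt_nonneg
  have hP : 0 ≤ (if n.Prime then 0 else vonMangoldt n) / (n:ℝ) := by
    split_ifs <;> positivity
  have hT : 0 ≤ x ^ (-(σ/2)) * (vonMangoldt n / (n:ℝ) ^ (1 + σ / 2)) := by positivity
  by_cases hn : (n : ZMod q) ∈ s
  · rw [sum_eq_single_of_mem (n : ZMod q) hn]
    swap
    · intro b _ hb
      simp [residueClass, hb.symm]
    have e : residueClass (n : ZMod q) n = vonMangoldt n := by simp [residueClass]
    rw [e]
    rcases Nat.eq_zero_or_pos n with rfl | hn0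
    · simp
    have hn1 : (1:ℝ) ≤ n := by exact_mod_cast hn0
    by_cases hp : n.Prime
    · have hxn := hs _ hn n hp rfl
      refine le_trans ?_ (le_add_of_nonneg_left hP)
      have : (n:ℝ) ^ (1 + σ) = (n:ℝ) ^ (1 + σ/2) * (n:ℝ) ^ (σ/2) := by
        rw [← Real.rpow_add (by linarith)]; ring_nf
      rw [this, Real.rpow_neg (by linarith)]
      have h2 : x ^ (σ/2) ≤ (n:ℝ) ^ (σ/2) := Real.rpow_le_rpow (by linarith) hxn.le (by linarith)
      have h3 : 0 < x ^ (σ/2) := Real.rpow_pos_of_pos (by linarith) _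
      rw [← div_div, div_eq_inv_mul]
      gcongr
    · refine le_trans ?_ (le_add_of_nonneg_right hT)
      rw [if_neg hp]
      gcongr
      conv_lhs => rw [← Real.rpow_one (n:ℝ)]
      exact Real.rpow_le_rpow_of_exponent_le hn1 (by linarith)
  · rw [sum_eq_zero]
    · linarith
    · intro b hb
      have : (n : ZMod q) ≠ b := fun h => hn (h ▸ hb)
      simp [residueClass, this]

open ArithmeticFunction vonMangoldt Finset in
lemma aux_zero {q : ℕ} [Fact q.Prime] (σ : ℝ) (hσ : 0 < σ) :
    ∑' n : ℕ, residueClass (0 : ZMod q) n / (n:ℝ) ^ (1 + σ) ≤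
      (∑' n : ℕ, (if n.Prime then 0 else vonMangoldt n) / (n:ℝ)) + 1 := by
  have hI1 : ∑' n : ℕ, (if n = q then (1:ℝ) else 0) = 1 := (hasSum_ite_eq q (1:ℝ)).tsum_eq
  have hIs : Summable (fun n : ℕ => (if n = q then (1:ℝ) else 0)) := (hasSum_ite_eq q (1:ℝ)).summable
  have hF := aux_FRsum (0 : ZMod q) (1 + σ) (by linarith)
  have hsum := aux_Psum.add hIs
  suffices hterm : ∀ n : ℕ, residueClass (0 : ZMod q) n / (n:ℝ) ^ (1 + σ) ≤
      (if n.Prime then 0 else vonMangoldt n) / (n:ℝ) + (if n = q then (1:ℝ) else 0) by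
    have h9 := hF.tsum_le_tsum hterm hsum
    rw [Summable.tsum_add aux_Psum hIs, hI1] at h9
    exact h9
  intro n
  have hΛ : 0 ≤ vonMangoldt n := vonMangoldt_nonneg
  have hP : 0 ≤ (if n.Prime then 0 else vonMangoldt n) / (n:ℝ) := by
    split_ifs <;> positivity
  have hI : (0:ℝ) ≤ if n = q then 1 else 0 := by split_ifs <;> norm_num
  by_cases hn : (n : ZMod q) = 0
  · have e : residueClass (0 : ZMod q) n = vonMangoldt n := by simp [residueClass, hn]
    rw [e]
    rcases Nat.eq_zero_or_pos n with rfl | hn0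
    · simpa using hI
    have hn1 : (1:ℝ) ≤ n := by exact_mod_cast hn0
    have h1 : (n:ℝ) ≤ (n:ℝ) ^ (1 + σ) := by
      conv_lhs => rw [← Real.rpow_one (n:ℝ)]
      exact Real.rpow_le_rpow_of_exponent_le hn1 (by linarith)
    have h2 : vonMangoldt n / (n:ℝ) ^ (1 + σ) ≤ vonMangoldt n / n := by gcongr
    by_cases hp : n.Prime
    · have hqn : n = q := ((Nat.prime_dvd_prime_iff_eq Fact.out hp).mp ((ZMod.natCast_eq_zero_iff _ _).mp hn)).symm
      rw [if_pos hqn]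
      refine le_trans ?_ (le_add_of_nonneg_left hP)
      refine h2.trans ?_
      rw [div_le_one (by linarith)]
      exact vonMangoldt_le_log.trans (Real.log_le_self (by linarith))
    · rw [if_neg hp]
      linarith
  · have : residueClass (0 : ZMod q) n = 0 := by simp [residueClass, hn]
    rw [this, zero_div]
    linarith

open ArithmeticFunction vonMangoldt Finset in
lemma aux_all {q : ℕ} [Fact q.Prime] (σ : ℝ) (hσ : 0 < σ) :
    ∑ a : ZMod q, ∑' n : ℕ, residueClass a n / (n:ℝ) ^ (1 + σ) = ∑' n : ℕ, vonMangoldt n / (n:ℝ) ^ (1 + σ) := by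
  classical
  rw [← Summable.tsum_finsetSum (fun a _ => aux_FRsum a (1 + σ) (by linarith))]
  refine tsum_congr fun n => ?_
  rw [sum_eq_single_of_mem (n : ZMod q) (mem_univ _)]
  · simp [residueClass]
  · intro b _ hb
    simp [residueClass, hb.symm]

open Finset in
set_option maxHeartbeats 800000 in
/-- Quantitative core: bound for the number of bad residue classes. -/
lemma aux_core : ∃ C : ℝ, 0 ≤ C ∧ ∀ (q : ℕ) [Fact q.Prime], 3 ≤ q → ∀ A d W B : ℝ, 0 < A → 0 < d →
    B = (2 + Real.log q) ^ 2 → W = 900 * (q:ℝ) ^ (3/4:ℝ) * B ^ 5 →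
    A / q ≤ 1 / (128 * B ^ 5) → A / q * B ≤ 1 / (400 * (q:ℝ) ^ (3/4:ℝ)) →
    2 * A * (C + W) ≤ q →
    ∀ s : Finset (ZMod q), (0 : ZMod q) ∉ s →
    (∀ a ∈ s, ∀ p : ℕ, p.Prime → (p : ZMod q) = a → Real.exp (d * q) < p) →
    (s.card : ℝ) ≤ 2 * A * (C + W) + 4 * Real.exp (-(d * A / 2)) * q := by
  obtain ⟨C0, hC0, hZ⟩ := aux_Z
  set CP := ∑' n : ℕ, (if n.Prime then 0 else ArithmeticFunction.vonMangoldt n) / (n:ℝ) with hCP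
  have hCP0 : 0 ≤ CP := tsum_nonneg fun n => by
    have : 0 ≤ ArithmeticFunction.vonMangoldt n := ArithmeticFunction.vonMangoldt_nonneg
    split_ifs <;> positivity
  refine ⟨C0 + CP + 1, by linarith, ?_⟩
  intro q _ hq3 A d W B hA hd hB hW h1 h2 h3 s hs0 hs
  classical
  have hq3' : (3:ℝ) ≤ q := by exact_mod_cast hq3
  have hq0 : (0:ℝ) < q := by linarith
  have hl := Real.log_nonneg (by linarith : (1:ℝ) ≤ q)
  have hB1 : 1 ≤ B := by rw [hB]; nlinarith
  set σ := A / q with hσdef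
  have hσ : 0 < σ := by positivity
  have hσ1 : σ ≤ 1 := by
    refine h1.trans ?_
    rw [div_le_one (by positivity)]
    have := one_le_pow₀ hB1 (n := 5)
    linarith
  obtain ⟨m, e, he0, hem, hesum⟩ := aux_dev hq3 B hB σ hσ h1 h2
  rw [← hW] at hesum
  have hx1 : 1 ≤ Real.exp (d * q) := Real.one_le_exp (by positivity)
  have hbad := aux_bad (Real.exp (d * q)) σ hx1 hσ s hs
  rw [← hCP] at hbad
  have hxe : Real.exp (d * q) ^ (-(σ/2)) = Real.exp (-(d * A / 2)) := by
    rw [← Real.exp_mul, hσdef]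
    congr 1; field_simp
  rw [hxe] at hbad
  set E := Real.exp (-(d * A / 2)) with hE
  have hE0 : 0 < E := Real.exp_pos _
  have hE1 : E ≤ 1 := by rw [hE]; exact Real.exp_le_one_iff.mpr (by have : 0 < d * A := by positivity
                                                                    linarith)
  have hZ1 := (abs_le.mp (hZ (1 + σ) (by linarith) (by linarith))).1
  have hZ2 := (abs_le.mp (hZ (1 + σ / 2) (by linarith) (by linarith))).2
  have hz0 := aux_zero (q := q) σ hσ
  rw [← hCP] at hz0
  have hall := aux_all (q := q) σ hσ
  rw [Fintype.sum_eq_add_sum_compl 0] at hall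
  -- upper bound for the sum over nonzero classes
  have hup : ∑ a ∈ ({0}ᶜ : Finset (ZMod q)), ∑' n : ℕ, ArithmeticFunction.vonMangoldt.residueClass a n / (n:ℝ) ^ (1 + σ) ≤ ((q:ℝ) - 1) * m + W := by
    have : ∑ a ∈ ({0}ᶜ : Finset (ZMod q)), ∑' n : ℕ, ArithmeticFunction.vonMangoldt.residueClass a n / (n:ℝ) ^ (1 + σ) ≤
        ∑ a ∈ ({0}ᶜ : Finset (ZMod q)), (m + e a) := by
      refine sum_le_sum fun a ha => ?_
      have := (abs_le.mp (hem a (by simpa using ha))).2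
      linarith
    rw [sum_add_distrib, sum_const, nsmul_eq_mul, card_compl, ZMod.card, card_singleton] at this
    have h5 : ∑ a ∈ ({0}ᶜ : Finset (ZMod q)), e a ≤ ∑ a, e a := sum_le_sum_of_subset_of_nonneg (subset_univ _) fun a _ _ => he0 a
    push_cast [show 1 ≤ q by omega] at this
    linarith
  have hlow : (s.card : ℝ) * m - W ≤ ∑ a ∈ s, ∑' n : ℕ, ArithmeticFunction.vonMangoldt.residueClass a n / (n:ℝ) ^ (1 + σ) := by
    have : ∑ a ∈ s, (m - e a) ≤ ∑ a ∈ s, ∑' n : ℕ, ArithmeticFunction.vonMangoldt.residueClass a n / (n:ℝ) ^ (1 + σ) := by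
      refine sum_le_sum fun a ha => ?_
      have := (abs_le.mp (hem a (fun h => hs0 (h ▸ ha)))).1
      linarith
    rw [sum_sub_distrib, sum_const, nsmul_eq_mul] at this
    have h5 : ∑ a ∈ s, e a ≤ ∑ a, e a := sum_le_sum_of_subset_of_nonneg (subset_univ _) fun a _ _ => he0 a
    linarith
  have hi1 : 1 / (1 + σ - 1) = q / A := by rw [add_sub_cancel_left, hσdef, one_div_div]
  have hi2 : 1 / (1 + σ / 2 - 1) = 2 * q / A := by rw [add_sub_cancel_left, hσdef]; field_simp
  rw [hi1] at hZ1
  rw [hi2] at hZ2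
  have hm : (q:ℝ) / A - (C0 + CP + 1 + W) ≤ (q - 1) * m := by linarith
  have hm2 : (q:ℝ) / (2 * A) ≤ (q - 1) * m := by
    have e1 : (q:ℝ) / A = q / (2 * A) + q / (2 * A) := by field_simp; ring
    have : C0 + CP + 1 + W ≤ q / (2 * A) := by rw [le_div_iff₀ (by positivity)]; linarith
    linarith
  have hm0 : 0 ≤ m := by
    have : 0 < (q:ℝ) / (2 * A) := by positivity
    by_contra hneg
    push Not at hneg
    nlinarith
  have hm3 : (q:ℝ) / (2 * A) ≤ q * m := by linarith
  have hm4 : 1 / (2 * A) ≤ m := by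
    rw [div_le_iff₀ (by positivity)] at hm3 ⊢
    nlinarith
  have hup2 : (s.card : ℝ) * m ≤ (C0 + CP + 1 + W) + E * (2 * q / A) := by
    have : E * ∑' n : ℕ, ArithmeticFunction.vonMangoldt n / (n:ℝ) ^ (1 + σ / 2) ≤ E * (2 * q / A + C0) := by
      refine mul_le_mul_of_nonneg_left (by linarith) hE0.le
    have h8 : E * C0 ≤ 1 * C0 := mul_le_mul_of_nonneg_right hE1 hC0
    rw [mul_add] at this
    linarith
  have h7 : (s.card : ℝ) * (1 / (2 * A)) ≤ (C0 + CP + 1 + W) + E * (2 * q / A) := le_trans (by gcongr) hup2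
  calc (s.card : ℝ) = (s.card : ℝ) * (1 / (2 * A)) * (2 * A) := by field_simp
    _ ≤ ((C0 + CP + 1 + W) + E * (2 * q / A)) * (2 * A) := by gcongr
    _ = _ := by field_simp; ring


open Filter Asymptotics in
lemma aux_asymp (c : ℝ) (hc : 0 < c) : ∀ᶠ x : ℝ in atTop, ((2 + Real.log x) ^ 2) ^ 5 ≤ c * x ^ (1/4:ℝ) := by
  have h := isLittleO_log_rpow_rpow_atTop (10:ℕ) (show (0:ℝ) < 1/4 by norm_num)
  have h1 := h.bound (show 0 < c / 1024 by positivity)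
  filter_upwards [h1, Real.tendsto_log_atTop.eventually_ge_atTop 2, eventually_ge_atTop 1] with x hx hl hx1
  rw [Real.rpow_natCast, Real.norm_of_nonneg (by positivity), Real.norm_of_nonneg (by positivity)] at hx
  calc ((2 + Real.log x) ^ 2) ^ 5 ≤ ((Real.log x + Real.log x) ^ 2) ^ 5 := by gcongr
    _ = 1024 * (Real.log x) ^ 10 := by ring
    _ ≤ 1024 * (c / 1024 * x ^ (1/4:ℝ)) := by gcongr
    _ = _ := by ring

open Filter Finset in
/-- Almost all residue classes modulo a large prime `q` contain a prime at most `exp (d q)`. -/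
lemma aux_nt (d ε : ℝ) (hd : 0 < d) (hε : 0 < ε) : ∃ Q : ℕ, ∀ q : ℕ, q.Prime → Q ≤ q → ∀ t : Finset ℕ, t ⊆ range q →
    ε * q ≤ t.card → ∃ a ∈ t, ∃ p : ℕ, p.Prime ∧ p % q = a ∧ (p:ℝ) ≤ Real.exp (d * q) := by
  obtain ⟨C, hC0, hcore⟩ := aux_core
  obtain ⟨A, hA, hAE⟩ : ∃ A : ℝ, 0 < A ∧ 4 * Real.exp (-(d * A / 2)) < ε / 4 := by
    have h1 : Tendsto (fun A : ℝ => d * A / 2) atTop atTop :=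
      (tendsto_id.const_mul_atTop hd).atTop_div_const (by norm_num)
    have h2 : Tendsto (fun A : ℝ => 4 * Real.exp (-(d * A / 2))) atTop (nhds 0) := by
      simpa using (Real.tendsto_exp_neg_atTop_nhds_zero.comp h1).const_mul 4
    exact ((eventually_gt_atTop 0).and (h2.eventually_lt_const (by positivity))).exists
  set κ := min 1 (ε / 4) with hκ
  have hκ0 : 0 < κ := by rw [hκ]; positivity
  have hκ1 : κ ≤ 1 := min_le_left _ _
  have hκ2 : κ ≤ ε / 4 := min_le_right _ _
  set c := κ / (3600 * A) with hc
  have hc0 : 0 < c := by positivity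
  have hcA : c * A = κ / 3600 := by rw [hc]; field_simp
  have hev : ∀ᶠ q : ℕ in atTop, ((2 + Real.log q) ^ 2) ^ 5 ≤ c * (q:ℝ) ^ (1/4:ℝ) ∧ 2 * A * C ≤ κ / 2 * q ∧ 1 < ε / 4 * q ∧ (3:ℝ) ≤ q := by
    have h1 := tendsto_natCast_atTop_atTop.eventually (aux_asymp c hc0)
    have ht : Tendsto (fun n : ℕ => (n:ℝ)) atTop atTop := tendsto_natCast_atTop_atTop
    have h2 := (ht.const_mul_atTop (show 0 < κ / 2 by positivity)).eventually_ge_atTop (2 * A * C)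
    have h3 := (ht.const_mul_atTop (show 0 < ε / 4 by positivity)).eventually_gt_atTop 1
    filter_upwards [h1, h2, h3, ht.eventually_ge_atTop 3] with q a b c d
    exact ⟨a, b, c, d⟩
  obtain ⟨Q, hQ⟩ := eventually_atTop.mp hev
  refine ⟨Q, fun q hq hQq t ht hcard => ?_⟩
  obtain ⟨h1, h2, h3, h4⟩ := hQ q hQq
  have hfact : Fact q.Prime := ⟨hq⟩
  have hq3 : 3 ≤ q := by exact_mod_cast h4
  have hq0 : (0:ℝ) < q := by linarith
  by_contra hno
  push Not at hno
  obtain ⟨B, hB⟩ : ∃ B : ℝ, B = (2 + Real.log q) ^ 2 := ⟨_, rfl⟩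
  rw [← hB] at h1
  have hl := Real.log_nonneg (by linarith : (1:ℝ) ≤ q)
  have hB1 : 1 ≤ B := by rw [hB]; nlinarith
  have hB5 : B ≤ B ^ 5 := le_self_pow₀ hB1 (by norm_num)
  have hx14 : (q:ℝ) ^ (1/4:ℝ) ≤ q := by
    conv_rhs => rw [← Real.rpow_one (q:ℝ)]
    exact Real.rpow_le_rpow_of_exponent_le (by linarith) (by norm_num)
  have hx1 : (q:ℝ) ^ (3/4:ℝ) * (q:ℝ) ^ (1/4:ℝ) = q := by
    rw [← Real.rpow_add hq0]; norm_num
  have hq34 : 0 < (q:ℝ) ^ (3/4:ℝ) := by positivity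
  obtain ⟨W, hW⟩ : ∃ W : ℝ, W = 900 * (q:ℝ) ^ (3/4:ℝ) * B ^ 5 := ⟨_, rfl⟩
  have hWle : W ≤ 900 * c * q := by
    rw [hW]
    calc 900 * (q:ℝ) ^ (3/4:ℝ) * B ^ 5 ≤ 900 * (q:ℝ) ^ (3/4:ℝ) * (c * (q:ℝ) ^ (1/4:ℝ)) := by gcongr
      _ = 900 * c * ((q:ℝ) ^ (3/4:ℝ) * (q:ℝ) ^ (1/4:ℝ)) := by ring
      _ = _ := by rw [hx1]
  have hAW : 2 * A * W ≤ κ / 2 * q := by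
    calc 2 * A * W ≤ 2 * A * (900 * c * q) := by gcongr
      _ = 1800 * (c * A) * q := by ring
      _ = _ := by rw [hcA]; ring
  have c1 : A / q ≤ 1 / (128 * B ^ 5) := by
    rw [div_le_div_iff₀ hq0 (by positivity)]
    calc A * (128 * B ^ 5) ≤ A * (128 * (c * (q:ℝ) ^ (1/4:ℝ))) := by gcongr
      _ = 128 * (c * A) * (q:ℝ) ^ (1/4:ℝ) := by ring
      _ ≤ 128 * (c * A) * q := by gcongr
      _ ≤ 1 * q := by rw [hcA]; nlinarith
  have c2 : A / q * B ≤ 1 / (400 * (q:ℝ) ^ (3/4:ℝ)) := by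
    rw [div_mul_eq_mul_div, div_le_div_iff₀ hq0 (by positivity)]
    calc A * B * (400 * (q:ℝ) ^ (3/4:ℝ)) ≤ A * (c * (q:ℝ) ^ (1/4:ℝ)) * (400 * (q:ℝ) ^ (3/4:ℝ)) := by
          have := hB5.trans h1
          gcongr
      _ = 400 * (c * A) * ((q:ℝ) ^ (3/4:ℝ) * (q:ℝ) ^ (1/4:ℝ)) := by ring
      _ ≤ 1 * q := by rw [hx1, hcA]; nlinarith
  have c3 : 2 * A * (C + W) ≤ κ * q := by linarith
  have hres := hcore q hq3 A d W B hA hd hB hW c1 c2 (by nlinarith) ((t.erase 0).image (fun a : ℕ => (a : ZMod q))) ?_ ?_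
  · rw [card_image_of_injOn] at hres
    · have h5 : (t.card : ℝ) ≤ (t.erase 0).card + 1 := by
        have := Finset.pred_card_le_card_erase (s := t) (a := 0)
        exact_mod_cast (by omega : t.card ≤ (t.erase 0).card + 1)
      have h6 : κ * q ≤ ε / 4 * q := by gcongr
      have h7 : 4 * Real.exp (-(d * A / 2)) * q ≤ ε / 4 * q := by gcongr
      have : 0 < ε * q := by positivity
      linarith
    · intro a ha b hb hab
      have ha' := mem_range.mp (ht (mem_of_mem_erase ha))
      have hb' := mem_range.mp (ht (mem_of_mem_erase hb))
      have := (ZMod.natCast_eq_natCast_iff' a b q).mp hab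
      rwa [Nat.mod_eq_of_lt ha', Nat.mod_eq_of_lt hb'] at this
  · intro h0
    obtain ⟨a, ha, hab⟩ := mem_image.mp h0
    have ha' := mem_range.mp (ht (mem_of_mem_erase ha))
    have := Nat.eq_zero_of_dvd_of_lt ((ZMod.natCast_eq_zero_iff _ _).mp hab) ha'
    exact ne_of_mem_erase ha this
  · intro a ha p hp hpa
    obtain ⟨b, hb, rfl⟩ := mem_image.mp ha
    have hb' := mem_range.mp (ht (mem_of_mem_erase hb))
    have := (ZMod.natCast_eq_natCast_iff' p b q).mp hpa
    rw [Nat.mod_eq_of_lt hb'] at this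
    exact hno b (mem_of_mem_erase hb) p hp this


open MeasureTheory Finset in
lemma aux_visit {X : Type*} [MetricSpace X] [CompactSpace X]
    [MeasurableSpace X] [BorelSpace X]
    (φ : ℝ → X → X)
    (ν : Measure X) [IsProbabilityMeasure ν] [ν.IsOpenPosMeasure]
    (huniq : ∀ x : X, ∀ g : X → ℝ, Continuous g →
      Filter.Tendsto (fun N : ℕ => (1 / (N : ℝ)) * ∑ a ∈ Finset.range N, g (φ (a : ℝ) x))
        Filter.atTop (nhds (∫ y, g y ∂ν)))
    (x y : X) (r : ℝ) (hr : 0 < r) :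
    ∃ γ : ℝ, 0 < γ ∧ ∃ N0 : ℕ, ∀ N ≥ N0, γ * N ≤ (((range N).filter fun a : ℕ => dist (φ (a:ℝ) x) y < r).card : ℝ) := by
  set g : X → ℝ := fun z => max 0 (r - dist z y) with hg
  have hgc : Continuous g := by fun_prop
  have hg0 : ∀ z, 0 ≤ g z := fun z => le_max_left _ _
  have hgr : ∀ z, g z ≤ r := fun z => max_le hr.le (by have := dist_nonneg (x := z) (y := y); linarith)
  have hpos : 0 < ∫ z, g z ∂ν := by
    refine hgc.integral_pos_of_hasCompactSupport_nonneg_nonzero (HasCompactSupport.of_compactSpace g) hg0 (x := y) ?_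
    simp [hg, hr.ne', hr.le]
  set I := ∫ z, g z ∂ν with hI
  have hev := (huniq x g hgc).eventually_const_lt (show I / 2 < I by linarith)
  obtain ⟨N0, hN0⟩ := Filter.eventually_atTop.mp hev
  refine ⟨I / (2 * r), by positivity, max N0 1, fun N hN => ?_⟩
  have h1 := hN0 N ((le_max_left _ _).trans hN)
  have hN1 : (1:ℝ) ≤ N := by exact_mod_cast (le_max_right _ _).trans hN
  have h2 : ∑ a ∈ range N, g (φ (a:ℝ) x) ≤ r * ((range N).filter fun a : ℕ => dist (φ (a:ℝ) x) y < r).card := by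
    have : ∑ a ∈ range N, g (φ (a:ℝ) x) ≤ ∑ a ∈ range N, if dist (φ (a:ℝ) x) y < r then r else 0 := by
      refine sum_le_sum fun a _ => ?_
      split_ifs with h
      · exact hgr _
      · refine max_le le_rfl (by linarith)
    rw [← sum_filter, sum_const, nsmul_eq_mul, mul_comm] at this
    exact this
  rw [one_div_mul_eq_div, lt_div_iff₀ (by linarith)] at h1
  have h3 : I / (2 * r) * N = (I / 2 * N) / r := by field_simp
  rw [h3, div_le_iff₀ hr]
  linarith

open Finset MeasureTheory in
/-- Abstract prime-orbit density: for a uniquely ergodic continuous flow `φ` on a compact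
metric space whose unique invariant measure `ν` has full support, and whose time-`K·qₙ`
maps are uniformly close to the identity for `0 ≤ K ≤ Kₙ = ⌈e^{d·qₙ}⌉`, every orbit
sampled at prime times is dense. -/
theorem stmt_12 {X : Type*} [MetricSpace X] [CompactSpace X]
    [MeasurableSpace X] [BorelSpace X]
    (φ : ℝ → X → X)
    (hφcont : Continuous fun p : ℝ × X => φ p.1 p.2)
    (hφ0 : ∀ x : X, φ 0 x = x)
    (hφadd : ∀ s t : ℝ, ∀ x : X, φ (s + t) x = φ s (φ t x))
    (ν : Measure X) [IsProbabilityMeasure ν] [ν.IsOpenPosMeasure]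
    (huniq : ∀ x : X, ∀ g : X → ℝ, Continuous g →
      Filter.Tendsto (fun N : ℕ => (1 / (N : ℝ)) * ∑ a ∈ Finset.range N, g (φ (a : ℝ) x))
        Filter.atTop (nhds (∫ y, g y ∂ν)))
    (q : ℕ → ℕ) (hqp : ∀ n, (q n).Prime)
    (c₀ δ : ℝ) (hc₀ : 0 < c₀) (hδ : 0 < δ)
    (hgrow : ∀ n : ℕ, (q (n + 1) : ℝ) ≥ c₀ * Real.exp (δ * (q n : ℝ)))
    (d : ℝ) (hd : 0 < d) (hdδ : d < δ)
    (hclose : ∀ ε > (0 : ℝ), ∃ N : ℕ, ∀ n ≥ N, ∀ x : X,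
      ∀ K : ℕ, K ≤ ⌈Real.exp (d * (q n : ℝ))⌉₊ →
        dist (φ ((K * q n : ℕ) : ℝ) x) x < ε) :
    ∀ x : X, Dense {y : X | ∃ p : ℕ, p.Prime ∧ φ (p : ℝ) x = y} := by
  intro x
  rw [Metric.dense_iff]
  intro y r hr
  by_cases hcase : ∀ Q N : ℕ, ∃ n ≥ N, Q ≤ q n
  · obtain ⟨γ, hγ, N0, hN0⟩ := aux_visit φ ν huniq x y (r / 2) (by positivity)
    obtain ⟨Q, hQ⟩ := aux_nt d γ hd hγ
    obtain ⟨N1, hN1⟩ := hclose (r / 2) (by positivity)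
    obtain ⟨n, hn, hqn⟩ := hcase (max Q N0) N1
    obtain ⟨a, ha, p, hp, hpa, hple⟩ := hQ (q n) (hqp n) ((le_max_left _ _).trans hqn) _ (filter_subset _ _)
      (hN0 (q n) ((le_max_right _ _).trans hqn))
    have ha2 := (mem_filter.mp ha).2
    refine ⟨φ (p:ℝ) x, ?_, p, hp, rfl⟩
    have hK : p / q n ≤ ⌈Real.exp (d * (q n : ℝ))⌉₊ := by
      have h1 : p ≤ ⌈Real.exp (d * (q n : ℝ))⌉₊ := by
        exact_mod_cast hple.trans (Nat.le_ceil _)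
      exact (Nat.div_le_self _ _).trans h1
    have h2 := hN1 n hn (φ (a:ℝ) x) (p / q n) hK
    have e : φ (p:ℝ) x = φ ((p / q n * q n : ℕ) : ℝ) (φ (a:ℝ) x) := by
      rw [← hφadd, ← Nat.cast_add, ← hpa, Nat.div_add_mod']
    rw [Metric.mem_ball, e]
    have := dist_triangle (φ ((p / q n * q n : ℕ) : ℝ) (φ (a:ℝ) x)) (φ (a:ℝ) x) y
    linarith
  · push Not at hcase
    obtain ⟨Q, N, hQN⟩ := hcase
    obtain ⟨p, hp, hpx⟩ : ∃ p : ℕ, p.Prime ∧ φ (p:ℝ) x = x := by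
      by_contra hno
      push Not at hno
      have h1 : ∀ p ∈ Finset.range Q, ∀ᶠ n in Filter.atTop, q n ≠ p := by
        intro p _
        by_cases hp : p.Prime
        · obtain ⟨M, hM⟩ := hclose (dist (φ (p:ℝ) x) x) (dist_pos.mpr (hno p hp))
          filter_upwards [Filter.eventually_ge_atTop M] with n hn h
          have := hM n hn x 1 (Nat.one_le_iff_ne_zero.mpr (Nat.ceil_pos.mpr (Real.exp_pos _)).ne')
          rw [one_mul, h] at this
          exact lt_irrefl _ this
        · exact Filter.Eventually.of_forall fun n h => hp (h ▸ hqp n)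
      have h2 := (Finset.eventually_all (Finset.range Q)).mpr h1
      obtain ⟨n, hn, hn2⟩ := (h2.and (Filter.eventually_ge_atTop N)).exists
      exact hn (q n) (Finset.mem_range.mpr (hQN n hn2)) rfl
    have hper : ∀ k a : ℕ, φ ((a + p * k : ℕ) : ℝ) x = φ (a:ℝ) x := by
      intro k a
      induction k with
      | zero => simp
      | succ k ih =>
        have : ((a + p * (k + 1) : ℕ) : ℝ) = ((a + p * k : ℕ) : ℝ) + p := by push_cast; ring
        rw [this, hφadd, hpx, ih]
    have hfin : (Set.univ : Set X).Finite := by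
      refine Set.Finite.subset ((Finset.range p).finite_toSet.image (fun a : ℕ => φ (a:ℝ) x)) fun z _ => ?_
      have hcl : IsClosed ((fun a : ℕ => φ (a:ℝ) x) '' (Finset.range p : Set ℕ)) :=
        ((Finset.range p).finite_toSet.image _).isClosed
      rw [← hcl.closure_eq, Metric.mem_closure_iff]
      intro ε hε
      obtain ⟨γ, hγ, N0, hN0⟩ := aux_visit φ ν huniq x z ε hε
      have h3 := hN0 (N0 + 1) (Nat.le_succ _)
      have h4 : 0 < (((Finset.range (N0+1)).filter fun a : ℕ => dist (φ (a:ℝ) x) z < ε).card : ℝ) :=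
        lt_of_lt_of_le (by positivity) h3
      obtain ⟨a, ha⟩ := Finset.card_pos.mp (by exact_mod_cast h4)
      refine ⟨φ (a:ℝ) x, ⟨a % p, by simpa using Nat.mod_lt _ hp.pos, ?_⟩, ?_⟩
      · have := hper (a / p) (a % p)
        rw [Nat.mod_add_div] at this
        exact this.symm
      · rw [dist_comm]; exact (Finset.mem_filter.mp ha).2
    have hfinite : Finite X := Set.finite_univ_iff.mp hfin
    have hdisc : DiscreteTopology X := inferInstance
    have hconst : ∀ t : ℝ, φ t x = x := by
      intro t
      have hc : Continuous fun t : ℝ => φ t x := hφcont.comp (by fun_prop : Continuous fun t : ℝ => (t, x))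
      have := PreconnectedSpace.constant (inferInstance : PreconnectedSpace ℝ) hc (x := t) (y := 0)
      rw [this, hφ0]
    obtain ⟨γ, hγ, N0, hN0⟩ := aux_visit φ ν huniq x y r hr
    have h3 := hN0 (N0 + 1) (Nat.le_succ _)
    have h4 : 0 < (((Finset.range (N0+1)).filter fun a : ℕ => dist (φ (a:ℝ) x) y < r).card : ℝ) :=
      lt_of_lt_of_le (by positivity) h3
    obtain ⟨a, ha⟩ := Finset.card_pos.mp (by exact_mod_cast h4)
    have ha2 := (Finset.mem_filter.mp ha).2
    rw [hconst] at ha2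
    exact ⟨x, ha2, 2, Nat.prime_two, hconst _⟩
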